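/- arXiv:2208.11158 — 9 statements merged into one kernel-verified Lean document; each statement's English description precedes it below -/
import Mathlib

section
/- Reznick's Newton polytope theorem: let f, p₁, …, p_t ∈ ℝ[x₁,…,xₙ] be real polynomials such that f = p₁² + ⋯ + p_t². Then for every i, the Newton polytope of pᵢ is contained in one half of the Newton polytope of f, i.e. New(pᵢ) ⊆ (1/2)·New(f). -/
open MvPolynomial Pointwise

/-- The Newton polytope of a polynomial: the convex hull (in `ℝⁿ`) of its support. -/
noncomputable def newtonPolytope {n : ℕ} (f : MvPolynomial (Fin n) ℝ) : Set (Fin n → ℝ) :=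
  convexHull ℝ ((fun (α : Fin n →₀ ℕ) (i : Fin n) => (α i : ℝ)) '' (f.support : Set (Fin n →₀ ℕ)))

/-- If `α` maximizes an injective additive map to an ordered monoid among all monomials of the
`p i`, then the coefficient of `∑ i, p i ^ 2` at `2α` is the sum of the squared coefficients
at `α`. -/
theorem coeff_sum_sq_add_self {σ ι R M : Type*} [CommSemiring R] [Fintype ι]
    [AddCommMonoid M] [LinearOrder M] [IsOrderedCancelAddMonoid M]
    (φ : (σ →₀ ℕ) → M) (hφ_add : ∀ β γ, φ (β + γ) = φ β + φ γ) (hφ : Function.Injective φ)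
    (p : ι → MvPolynomial σ R) (α : σ →₀ ℕ)
    (hα : ∀ i, ∀ β ∈ (p i).support, φ β ≤ φ α) :
    coeff (α + α) (∑ i, p i ^ 2) = ∑ i, coeff α (p i) ^ 2 := by
  classical
  rw [coeff_sum]
  refine Finset.sum_congr rfl fun i _ => ?_
  rw [sq, coeff_mul, sq]
  refine Finset.sum_eq_single (α, α) ?_ (by simp)
  rintro ⟨β, γ⟩ hmem hne
  rw [Finset.HasAntidiagonal.mem_antidiagonal] at hmem
  by_cases hβ : coeff β (p i) = 0
  · simp [hβ]
  by_cases hγ : coeff γ (p i) = 0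
  · simp [hγ]
  have hsum : φ β + φ γ = φ α + φ α := by rw [← hφ_add, ← hφ_add, hmem]
  obtain ⟨h₁, h₂⟩ := (add_eq_add_iff_eq_and_eq (hα i β (mem_support_iff.2 hβ))
    (hα i γ (mem_support_iff.2 hγ))).1 hsum
  exact absurd (Prod.ext (hφ h₁) (hφ h₂)) hne

/-- A linear functional on the exponents of a sum of squares attains its maximum over the monomials
of the summands at some `α` for which `2α` is an exponent of the sum. -/
theorem exists_add_self_mem_support_sum_sq {n : ℕ} {ι R : Type*} [CommRing R] [LinearOrder R]
    [IsStrictOrderedRing R] [Fintype ι] (p : ι → MvPolynomial (Fin n) R)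
    (l : (Fin n →₀ ℕ) →+ ℝ) (i : ι) (δ : Fin n →₀ ℕ) (hδ : δ ∈ (p i).support) :
    ∃ α, l δ ≤ l α ∧ α + α ∈ (∑ i, p i ^ 2).support := by
  classical
  let φ : (Fin n →₀ ℕ) → ℝ ×ₗ Lex (Fin n →₀ ℕ) := fun β => toLex (l β, toLex β)
  have hφ_add : ∀ β γ, φ (β + γ) = φ β + φ γ := fun β γ => by
    simp only [φ, map_add]; rfl
  have hφ : Function.Injective φ := fun β γ h => (Prod.ext_iff.1 (toLex.injective h)).2
  obtain ⟨α, hαS, hα⟩ := (Finset.univ.biUnion fun j => (p j).support).exists_max_image φ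
    ⟨δ, Finset.mem_biUnion.2 ⟨i, Finset.mem_univ i, hδ⟩⟩
  have hmax : ∀ j, ∀ β ∈ (p j).support, φ β ≤ φ α := fun j β hβ =>
    hα β (Finset.mem_biUnion.2 ⟨j, Finset.mem_univ j, hβ⟩)
  obtain ⟨j, -, hj⟩ := Finset.mem_biUnion.1 hαS
  refine ⟨α, Prod.Lex.monotone_fst _ _ (hmax i δ hδ), ?_⟩
  rw [mem_support_iff, coeff_sum_sq_add_self φ hφ_add hφ p α hmax]
  exact (Finset.sum_pos' (fun k _ => sq_nonneg (coeff α (p k)))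
    ⟨j, Finset.mem_univ j, sq_pos_of_ne_zero (mem_support_iff.1 hj)⟩).ne'

/-- **Reznick's Newton polytope theorem**: if `f = p₁² + ⋯ + p_t²`, then for every `i`,
`New(pᵢ) ⊆ (1/2)·New(f)`. -/
theorem reznick_newton_polytope (n t : ℕ)
    (f : MvPolynomial (Fin n) ℝ) (p : Fin t → MvPolynomial (Fin n) ℝ)
    (hf : f = ∑ i, (p i) ^ 2) :
    ∀ i : Fin t, newtonPolytope (p i) ⊆ (1 / 2 : ℝ) • newtonPolytope f := by
  intro i
  have hclosed : IsClosed ((1 / 2 : ℝ) • newtonPolytope f) :=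
    ((f.support.finite_toSet.image _).isCompact_convexHull ℝ |>.smul _).isClosed
  have hconvex : Convex ℝ ((1 / 2 : ℝ) • newtonPolytope f) := (convex_convexHull ℝ _).smul _
  refine convexHull_min ?_ hconvex
  rintro _ ⟨δ, hδ, rfl⟩
  by_contra hnot
  obtain ⟨l, u, hlt, hu⟩ := geometric_hahn_banach_closed_point hconvex hclosed hnot
  let L : (Fin n →₀ ℕ) →+ ℝ :=
    { toFun := fun β => l fun k => (β k : ℝ)
      map_zero' := by simp only [Finsupp.coe_zero, Pi.zero_apply, Nat.cast_zero]; exact map_zero l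
      map_add' := fun β γ => by
        rw [← map_add]
        congr 1
        ext k
        simp }
  obtain ⟨α, hle, hα⟩ := exists_add_self_mem_support_sum_sq p L i δ hδ
  rw [← hf] at hα
  have hmem : (fun k => (α k : ℝ)) ∈ (1 / 2 : ℝ) • newtonPolytope f := by
    refine ⟨_, subset_convexHull ℝ _ ⟨α + α, hα, rfl⟩, ?_⟩
    ext k
    simp only [Pi.smul_apply, Finsupp.add_apply, Nat.cast_add, smul_eq_mul]
    ring
  exact absurd (hu.trans_le hle) (hlt _ hmem).not_gt
end

section
/- Let G be a finite simple chordal graph with vertex set V = {1,…,n} and maximal cliques C₁,…,C_p, and let Q be a real symmetric n×n matrix with sparsity pattern G, i.e. Q_{ij} = 0 whenever i ≠ j and {i,j} is not an edge of G. Then Q is positive semidefinite if and only if there exist real symmetric positive semidefinite n×n matrices Q₁,…,Q_p with Q = Q₁ + ⋯ + Q_p such that for each k, (Q_k)_{ij} = 0 unless both i ∈ C_k and j ∈ C_k. -/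
/-- A simple graph is chordal if every cycle of length at least four has a chord, i.e. an edge
of the graph joining two vertices of the cycle which is not an edge of the cycle. -/
def SimpleGraph.IsChordal {V : Type*} (G : SimpleGraph V) : Prop :=
  ∀ (v : V) (w : G.Walk v v), w.IsCycle → 4 ≤ w.length →
    ∃ u u' : V, u ∈ w.support ∧ u' ∈ w.support ∧ G.Adj u u' ∧ s(u, u') ∉ w.edges

/-- `C` is a maximal clique of `G`. -/
def SimpleGraph.IsMaxClique' {V : Type*} (G : SimpleGraph V) (C : Finset V) : Prop :=
  G.IsClique (C : Set V) ∧ ∀ D : Finset V, G.IsClique (D : Set V) → C ⊆ D → C = D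

open Matrix

namespace SimpleGraph

variable {V : Type*} {G : SimpleGraph V}

/-- A chord of a walk splits off a middle segment, so in a walk of minimal length among those
supported in `T`, vertices which are adjacent in `G` are joined by an edge of the walk. -/
theorem Walk.mem_edges_of_adj_of_append {T : Set V} {x y u u' : V} (q : G.Walk x u)
    (r : G.Walk u y) (hT : ∀ z ∈ (q.append r).support, z ∈ T)
    (hmin : ∀ w : G.Walk x y, (∀ z ∈ w.support, z ∈ T) → (q.append r).length ≤ w.length)
    (hu' : u' ∈ r.support) (h : G.Adj u u') : s(u, u') ∈ (q.append r).edges := by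
  obtain ⟨r₁, r₂, rfl⟩ := r.mem_support_iff_exists_append.mp hu'
  have hle := hmin (q.append (Walk.cons h r₂)) (by
    intro z hz
    apply hT
    simp only [Walk.mem_support_append_iff, Walk.support_cons, List.mem_cons] at hz ⊢
    rcases hz with hz | rfl | hz
    · exact Or.inl hz
    · exact Or.inl q.end_mem_support
    · exact Or.inr (Or.inr hz))
  simp only [Walk.length_append, Walk.length_cons] at hle
  cases r₁ with
  | nil => exact (h.ne rfl).elim
  | cons h' r₁ =>
    cases r₁ with
    | nil => simp
    | cons => simp only [Walk.length_cons] at hle; omega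

theorem Walk.mem_edges_of_adj_of_length_minimal {T : Set V} {x y u u' : V} (w : G.Walk x y)
    (hT : ∀ z ∈ w.support, z ∈ T)
    (hmin : ∀ w' : G.Walk x y, (∀ z ∈ w'.support, z ∈ T) → w.length ≤ w'.length)
    (hu : u ∈ w.support) (hu' : u' ∈ w.support) (h : G.Adj u u') : s(u, u') ∈ w.edges := by
  obtain ⟨q, r, rfl⟩ := w.mem_support_iff_exists_append.mp hu
  rcases Walk.mem_support_append_iff _ _ |>.mp hu' with hq | hr
  · have := Walk.mem_edges_of_adj_of_append (T := T) r.reverse q.reverse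
      (by simpa [or_comm] using hT)
      (fun w' hw' => by
        have := hmin w'.reverse (by simpa using hw')
        simpa [add_comm] using this)
      (by simpa using hq) h
    simpa [or_comm] using this
  · exact Walk.mem_edges_of_adj_of_append q r hT hmin hr h

theorem Walk.exists_isPath_length_minimal {T : Set V} {x y : V}
    (h : ∃ w : G.Walk x y, ∀ z ∈ w.support, z ∈ T) :
    ∃ w : G.Walk x y, w.IsPath ∧ (∀ z ∈ w.support, z ∈ T) ∧
      ∀ w' : G.Walk x y, (∀ z ∈ w'.support, z ∈ T) → w.length ≤ w'.length := by
  classical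
  let s : Set (G.Walk x y) := {w | ∀ z ∈ w.support, z ∈ T}
  have hs : s.Nonempty := h
  obtain ⟨w, hw, hmin⟩ := WellFounded.has_min (measure (fun w : G.Walk x y => w.length)).wf s hs
  refine ⟨w.bypass, w.bypass_isPath,
    fun z hz => hw z (w.support_bypass_subset_support hz), fun w' hw' => ?_⟩
  exact w.length_bypass_le_length.trans (not_lt.mp (hmin w' hw'))

/-- In a chordal graph, two neighbors `x`, `y` of `b` are adjacent as soon as they are joined by
a walk whose other vertices are neither `b` nor adjacent to `b`. -/
theorem IsChordal.adj_of_walk (hG : G.IsChordal) {b x y : V} (hxy : x ≠ y) (hbx : G.Adj b x)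
    (hby : G.Adj b y) (w : G.Walk x y)
    (hw : ∀ z ∈ w.support, z ≠ b ∧ (G.Adj b z → z = x ∨ z = y)) : G.Adj x y := by
  by_contra hnadj
  obtain ⟨w, hpath, hT, hmin⟩ := Walk.exists_isPath_length_minimal
    (T := {z | z ≠ b ∧ (G.Adj b z → z = x ∨ z = y)}) ⟨w, hw⟩
  have hb : b ∉ w.support := fun h => (hT b h).1 rfl
  have hlen : 2 ≤ w.length := by
    by_contra! hlt
    cases w with
    | nil => exact hxy rfl
    | cons h w =>
      cases w with
      | nil => exact hnadj h
      | cons => simp only [Walk.length_cons] at hlt; omega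
  have hcyc : (Walk.cons hbx (w.concat hby.symm)).IsCycle := by
    rw [Walk.cons_isCycle_iff]
    refine ⟨hpath.concat hb hby.symm, ?_⟩
    rw [Walk.edges_concat, List.concat_eq_append, List.mem_append]
    rintro (h | h)
    · exact hb (w.fst_mem_support_of_mem_edges h)
    · simp only [List.mem_singleton, Sym2.eq_iff] at h
      rcases h with ⟨rfl, -⟩ | ⟨-, rfl⟩
      · exact hby.ne rfl
      · exact hxy rfl
  obtain ⟨u, u', hu, hu', hadj, hne⟩ := hG b _ hcyc (by simp; omega)
  have hb_edge : ∀ z ∈ w.support, G.Adj b z →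
      s(b, z) ∈ (Walk.cons hbx (w.concat hby.symm)).edges := by
    intro z hz hbz
    rcases (hT z hz).2 hbz with rfl | rfl <;> simp [Walk.edges_concat, Sym2.eq_swap]
  have hsupp : ∀ z ∈ (Walk.cons hbx (w.concat hby.symm)).support, z = b ∨ z ∈ w.support := by
    intro z hz
    simp only [Walk.support_cons, Walk.support_concat, List.mem_cons,
      List.mem_append, List.not_mem_nil, or_false] at hz
    tauto
  rcases hsupp u hu with rfl | hwu <;> rcases hsupp u' hu' with rfl | hwu'
  · exact hadj.ne rfl
  · exact hne (hb_edge _ hwu' hadj)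
  · exact hne (Sym2.eq_swap ▸ hb_edge _ hwu hadj.symm)
  · apply hne
    have := w.mem_edges_of_adj_of_length_minimal hT hmin hwu hwu' hadj
    simp [Walk.edges_concat, this]

/-- Every nonempty finite set of vertices of a chordal graph contains a vertex which is simplicial
in the subgraph induced on this set. -/
theorem IsChordal.exists_simplicial [Finite V] (hG : G.IsChordal) (S : Set V) (hS : S.Nonempty) :
    ∃ v ∈ S, G.IsClique (S ∩ G.neighborSet v) := by
  induction S using WellFoundedLT.induction with
  | ind S ih =>
  by_cases hclique : G.IsClique S
  · obtain ⟨v, hv⟩ := hS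
    exact ⟨v, hv, hclique.subset Set.inter_subset_left⟩
  rw [isClique_iff, Set.Pairwise] at hclique
  push Not at hclique
  obtain ⟨a, ha, c, hc, hac, hnac⟩ := hclique
  let F : Set (Set V) := {A | A ⊆ S ∧ A.Nonempty ∧
    (∀ u ∈ A, ∀ v ∈ A, ∃ w : G.Walk u v, ∀ z ∈ w.support, z ∈ A) ∧
    ∃ b ∈ S, b ∉ A ∧ ∀ z ∈ A, ¬ G.Adj b z}
  have haF : {a} ∈ F := by
    refine ⟨by simpa using ha, Set.singleton_nonempty a, ?_, c, hc, by simpa using hac.symm, ?_⟩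
    · rintro _ rfl _ rfl
      exact ⟨Walk.nil, by simp⟩
    · rintro _ rfl h
      exact hnac h.symm
  obtain ⟨A, ⟨hAS, ⟨a₀, ha₀⟩, hconn, hfar⟩, hmax⟩ := F.toFinite.exists_maximal ⟨_, haF⟩
  let B : Set V := {b | b ∈ S ∧ b ∉ A ∧ ∀ z ∈ A, ¬ G.Adj b z}
  have hBS : B ⊂ S := ⟨fun b hb => hb.1, fun h => (h (hAS ha₀)).2.1 ha₀⟩
  obtain ⟨b, hb, hbB⟩ := ih B hBS hfar
  have hadj : ∀ x ∈ S, x ∉ B → x ∉ A → ∀ b ∈ B, G.Adj b x := by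
    intro x hx hxB hxA b hb
    by_contra hbx
    obtain ⟨z, hz, hxz⟩ : ∃ z ∈ A, G.Adj x z := by
      by_contra! h
      exact hxB ⟨hx, hxA, h⟩
    refine hxA (hmax (y := insert x A) ⟨Set.insert_subset hx hAS, Set.insert_nonempty x A, ?_,
      b, hb.1, ?_, ?_⟩ (Set.subset_insert x A) (Set.mem_insert x A))
    · have hx_walk : ∀ v ∈ A, ∃ w : G.Walk x v, ∀ z ∈ w.support, z ∈ insert x A := by
        intro v hv
        obtain ⟨w, hw⟩ := hconn z hz v hv
        exact ⟨Walk.cons hxz w, by simpa using fun z hz => Or.inr (hw z hz)⟩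
      rintro u (rfl | hu) v (rfl | hv)
      · exact ⟨Walk.nil, by simp⟩
      · exact hx_walk v hv
      · obtain ⟨w, hw⟩ := hx_walk u hu
        exact ⟨w.reverse, by simpa using hw⟩
      · obtain ⟨w, hw⟩ := hconn u hu v hv
        exact ⟨w, fun z hz => Or.inr (hw z hz)⟩
    · rintro (rfl | h)
      · exact hxB hb
      · exact hb.2.1 h
    · rintro y (rfl | hy)
      · exact hbx
      · exact hb.2.2 y hy
  refine ⟨b, hb.1, ?_⟩
  rintro x ⟨hxS, hbx⟩ y ⟨hyS, hby⟩ hxy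
  rw [mem_neighborSet] at hbx hby
  have hxA : x ∉ A := fun h => hb.2.2 x h hbx
  have hyA : y ∉ A := fun h => hb.2.2 y h hby
  by_cases hxB : x ∈ B <;> by_cases hyB : y ∈ B
  · exact hbB ⟨hxB, hbx⟩ ⟨hyB, hby⟩ hxy
  · exact hadj y hyS hyB hyA x hxB
  · exact (hadj x hxS hxB hxA y hyB).symm
  · obtain ⟨z, hz, hxz⟩ : ∃ z ∈ A, G.Adj x z := by
      by_contra! h
      exact hxB ⟨hxS, hxA, h⟩
    obtain ⟨z', hz', hyz'⟩ : ∃ z ∈ A, G.Adj y z := by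
      by_contra! h
      exact hyB ⟨hyS, hyA, h⟩
    obtain ⟨w, hw⟩ := hconn z hz z' hz'
    refine hG.adj_of_walk hxy hbx hby (Walk.cons hxz (w.concat hyz'.symm)) fun u hu => ?_
    have hu : u = x ∨ u ∈ A ∨ u = y := by
      simp only [Walk.support_cons, Walk.support_concat, List.mem_cons,
        List.mem_append, List.not_mem_nil, or_false] at hu
      exact hu.imp_right (Or.imp_left (hw u))
    rcases hu with rfl | hu | rfl
    · exact ⟨hbx.ne', fun _ => Or.inl rfl⟩
    · exact ⟨fun h => hb.2.1 (h ▸ hu), fun h => (hb.2.2 u hu h).elim⟩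
    · exact ⟨hby.ne', fun _ => Or.inr rfl⟩

theorem IsClique.exists_isMaxClique' [Finite V] {D : Finset V} (hD : G.IsClique (D : Set V)) :
    ∃ C : Finset V, G.IsMaxClique' C ∧ D ⊆ C := by
  obtain ⟨C, hDC, hC⟩ := (Set.toFinite {C : Finset V | G.IsClique (C : Set V)}).exists_le_maximal hD
  exact ⟨C, ⟨hC.prop, fun E hE hCE => hC.eq_of_le hE hCE⟩, hDC⟩

end SimpleGraph

namespace Matrix.PosSemidef

variable {ι : Type*} {Q : Matrix ι ι ℝ}

theorem apply_eq_zero_of_diag_eq_zero (hQ : Q.PosSemidef) {i : ι} (hi : Q i i = 0) (j : ι) :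
    Q i j = 0 := by
  have hdet := (hQ.submatrix ![i, j]).det_nonneg
  have hsymm : Q j i = Q i j := by simpa using hQ.isHermitian.apply i j
  simp only [det_fin_two, submatrix_apply, cons_val_zero, cons_val_one, hi, hsymm] at hdet
  nlinarith

/-- Eliminating one row and column of a positive semidefinite matrix leaves a positive
semidefinite matrix. -/
theorem sub_vecMulVec_row [Fintype ι] (hQ : Q.PosSemidef) (v : ι) :
    (Q - (Q v v)⁻¹ • vecMulVec (Q v) (Q v)).PosSemidef := by
  classical
  have hsymm : ∀ i j, Q j i = Q i j := fun i j => by simpa using hQ.isHermitian.apply i j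
  convert hQ.conjTranspose_mul_mul_same
    (1 - vecMulVec (Pi.single v 1) ((Q v v)⁻¹ • Q v)) using 1
  have hcol : Q *ᵥ Pi.single v 1 = Q v := by
    ext i
    simp [hsymm]
  rw [Matrix.mul_assoc, Matrix.mul_sub, mul_vecMulVec, hcol]
  ext i j
  by_cases hv : Q v v = 0
  · simp [hv]
  · simp [Matrix.sub_mul, Matrix.mul_sub, vecMulVec_mul,
      vecMulVec_apply, single_vecMul]
    field_simp
    ring

end Matrix.PosSemidef

/-- A positive semidefinite matrix with chordal sparsity pattern belongs to the additive submonoid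
generated by the positive semidefinite matrices supported on cliques. -/
theorem SimpleGraph.IsChordal.posSemidef_mem_of_clique {ι : Type*} [Fintype ι] {G : SimpleGraph ι}
    (hG : G.IsChordal) (M : AddSubmonoid (Matrix ι ι ℝ))
    (hM : ∀ (D : Set ι) (P : Matrix ι ι ℝ), G.IsClique D → P.PosSemidef →
      (∀ i j, ¬(i ∈ D ∧ j ∈ D) → P i j = 0) → P ∈ M)
    (S : Set ι) (Q : Matrix ι ι ℝ) (hQ : Q.PosSemidef)
    (hsp : ∀ i j, i ≠ j → ¬ G.Adj i j → Q i j = 0)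
    (hS : ∀ i j, ¬(i ∈ S ∧ j ∈ S) → Q i j = 0) : Q ∈ M := by
  induction S using WellFoundedLT.induction generalizing Q with
  | ind S ih =>
  rcases S.eq_empty_or_nonempty with rfl | hne
  · obtain rfl : Q = 0 := by
      ext i j
      exact hS i j (by simp)
    exact M.zero_mem
  obtain ⟨v, hv, hclique⟩ := hG.exists_simplicial S hne
  have hsymm : ∀ i j, Q j i = Q i j := fun i j => by simpa using hQ.isHermitian.apply i j
  let D : Set ι := insert v (S ∩ G.neighborSet v)
  have hD : G.IsClique D := hclique.insert fun b hb _ => hb.2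
  have hrow : ∀ i, i ∉ D → Q v i = 0 := by
    intro i hi
    by_cases hiS : i ∈ S
    · exact hsp v i (fun h => hi (Or.inl h.symm)) fun h => hi (Or.inr ⟨hiS, h⟩)
    · exact hS v i fun h => hiS h.2
  have hP : ∀ i j, ¬(i ∈ D ∧ j ∈ D) → ((Q v v)⁻¹ • vecMulVec (Q v) (Q v)) i j = 0 := by
    intro i j hij
    rcases not_and_or.mp hij with h | h <;> simp [vecMulVec_apply, hrow _ h]
  have helim : ∀ j, (Q - (Q v v)⁻¹ • vecMulVec (Q v) (Q v)) v j = 0 := by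
    intro j
    by_cases hvv : Q v v = 0
    · simp [hvv, hQ.apply_eq_zero_of_diag_eq_zero hvv]
    · simp [vecMulVec_apply, hvv]
  have hrest : Q - (Q v v)⁻¹ • vecMulVec (Q v) (Q v) ∈ M := by
    have hpsd := hQ.sub_vecMulVec_row v
    refine ih (S \ {v}) ⟨Set.sdiff_subset, fun h => (h hv).2 rfl⟩ _ hpsd ?_ ?_
    · intro i j hij hadj
      rw [Matrix.sub_apply, hsp i j hij hadj, hP i j fun h => hadj (hD h.1 h.2 hij), sub_zero]
    · intro i j hij
      by_cases hi : i = v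
      · exact hi ▸ helim j
      by_cases hj : j = v
      · have := hpsd.isHermitian.apply i j
        rw [← this, hj, helim, star_zero]
      have hij' : ¬(i ∈ S ∧ j ∈ S) := fun h => hij ⟨⟨h.1, hi⟩, ⟨h.2, hj⟩⟩
      have hDS : D ⊆ S := Set.insert_subset hv Set.inter_subset_left
      rw [Matrix.sub_apply, hS i j hij', hP i j fun h => hij' ⟨hDS h.1, hDS h.2⟩, sub_zero]
  have hstar : (vecMulVec (Q v) (Q v)).PosSemidef := by
    simpa using posSemidef_vecMulVec_self_star (Q v)
  have := M.add_mem hrest (hM D _ hD (hstar.smul (inv_nonneg.mpr hQ.diag_nonneg)) hP)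
  rwa [sub_add_cancel] at this

/-- The matrices which are sums of positive semidefinite matrices supported on the sets `C k`. -/
def Matrix.sumPosSemidefSupported {ι κ : Type*} [Fintype κ] (C : κ → Finset ι) :
    AddSubmonoid (Matrix ι ι ℝ) where
  carrier := {Q | ∃ P : κ → Matrix ι ι ℝ, (∀ k, (P k).PosSemidef) ∧ Q = ∑ k, P k ∧
    ∀ (k : κ) (i j : ι), ¬(i ∈ C k ∧ j ∈ C k) → P k i j = 0}
  zero_mem' := ⟨0, fun _ => PosSemidef.zero, by simp, fun _ _ _ _ => rfl⟩
  add_mem' := by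
    rintro _ _ ⟨P, hP, rfl, hPC⟩ ⟨P', hP', rfl, hPC'⟩
    exact ⟨P + P', fun k => (hP k).add (hP' k), by simp [Finset.sum_add_distrib],
      fun k i j h => by simp [hPC k i j h, hPC' k i j h]⟩

/-- **Decomposition of sparse PSD matrices with chordal sparsity pattern**: if `G` is chordal
with maximal cliques `C₁,…,C_p` and `Q` is symmetric with sparsity pattern `G`, then `Q` is
positive semidefinite iff `Q = Q₁ + ⋯ + Q_p` for PSD matrices `Q_k` supported on `C_k × C_k`. -/
theorem chordal_psd_decomposition (n p : ℕ) (G : SimpleGraph (Fin n))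
    (hchordal : G.IsChordal)
    (C : Fin p → Finset (Fin n))
    (hmax : ∀ k, G.IsMaxClique' (C k))
    (hall : ∀ D : Finset (Fin n), G.IsMaxClique' D → ∃ k, D = C k)
    (Q : Matrix (Fin n) (Fin n) ℝ) (hQsym : Q.IsSymm)
    (hQsp : ∀ i j : Fin n, i ≠ j → ¬ G.Adj i j → Q i j = 0) :
    Q.PosSemidef ↔
      ∃ Qk : Fin p → Matrix (Fin n) (Fin n) ℝ,
        (∀ k, (Qk k).PosSemidef) ∧ Q = ∑ k, Qk k ∧
        ∀ (k : Fin p) (i j : Fin n), ¬(i ∈ C k ∧ j ∈ C k) → Qk k i j = 0 := by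
  constructor
  · intro hQ
    refine hchordal.posSemidef_mem_of_clique (sumPosSemidefSupported C) ?_ Set.univ Q hQ hQsp
      (by simp)
    intro D P hD hP hPD
    classical
    obtain ⟨E, hE, hDE⟩ := SimpleGraph.IsClique.exists_isMaxClique' (D := D.toFinset)
      (by simpa using hD)
    obtain ⟨k, rfl⟩ := hall E hE
    refine ⟨Pi.single k P, fun l => ?_, by simp, fun l i j hij => ?_⟩
    · rcases eq_or_ne l k with rfl | hl
      · simpa using hP
      · simpa [hl] using PosSemidef.zero
    · rcases eq_or_ne l k with rfl | hl
      · simpa using hPD i j fun h => hij ⟨hDE (by simpa using h.1), hDE (by simpa using h.2)⟩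
      · simp [hl]
  · rintro ⟨P, hP, rfl, -⟩
    exact posSemidef_sum _ fun k _ => hP k
end

section
/- Let G be a finite simple chordal graph with vertex set V = {1,…,n} and maximal cliques C₁,…,C_p, and let Q be a real symmetric n×n matrix with sparsity pattern G, i.e. Q_{ij} = 0 whenever i ≠ j and {i,j} is not an edge of G. Then Q admits a positive semidefinite completion (there exists a real symmetric positive semidefinite n×n matrix Q̂ with Q̂_{ij} = Q_{ij} whenever i = j or {i,j} is an edge of G) if and only if for every maximal clique C_k of G the principal submatrix (Q_{ij})_{i,j∈C_k} is positive semidefinite. -/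
open scoped InnerProductSpace

namespace SimpleGraph

variable {V : Type*} {G : SimpleGraph V}

/-- Reachable vertices are joined by an induced path. -/
theorem Reachable.exists_isPath_chordless {u v : V} (h : G.Reachable u v) :
    ∃ p : G.Walk u v, p.IsPath ∧
      ∀ x ∈ p.support, ∀ y ∈ p.support, G.Adj x y → s(x, y) ∈ p.edges := by
  obtain ⟨p, hp, hd⟩ := h.exists_path_of_dist
  have key : ∀ i j, i < j → j ≤ p.length → G.Adj (p.getVert i) (p.getVert j) →
      s(p.getVert i, p.getVert j) ∈ p.edges := by
    intro i j hij hj hadj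
    have hle := G.dist_le ((p.take i).append (Walk.cons hadj (p.drop j)))
    simp only [Walk.length_append, Walk.length_cons, Walk.take_length, Walk.drop_length] at hle
    obtain rfl : j = i + 1 := by omega
    exact (p.mk_mem_edges_iff_exists).2 ⟨i, by omega, rfl⟩
  refine ⟨p, hp, fun x hx y hy hadj => ?_⟩
  obtain ⟨i, rfl, hi⟩ := Walk.mem_support_iff_exists_getVert.1 hx
  obtain ⟨j, rfl, hj⟩ := Walk.mem_support_iff_exists_getVert.1 hy
  rcases lt_trichotomy i j with hij | rfl | hij
  · exact key i j hij hj hadj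
  · exact (G.irrefl hadj).elim
  · rw [Sym2.eq_swap]
    exact key j i hij hi hadj.symm

/-- In a chordal graph, two neighbours of `a` that are joined by a path whose inner vertices are
neither `a` nor neighbours of `a` are adjacent. -/
theorem IsChordal.adj_of_reachable_induce (hG : G.IsChordal) {a s t : V} {T : Set V}
    (hs : s ∈ T) (ht : t ∈ T) (has : G.Adj a s) (hat : G.Adj a t) (hst : s ≠ t) (haT : a ∉ T)
    (hT : ∀ v ∈ T, G.Adj a v → v = s ∨ v = t)
    (hr : (G.induce T).Reachable ⟨s, hs⟩ ⟨t, ht⟩) : G.Adj s t := by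
  by_contra hnadj
  obtain ⟨p, hp, hchord⟩ := hr.exists_isPath_chordless
  let q : G.Walk s t := p.map (Embedding.induce T).toHom
  have hq : q.IsPath := hp.map (Embedding.induce (G := G) T).injective
  have hqT : ∀ v ∈ q.support, ∃ hv : v ∈ T, (⟨v, hv⟩ : T) ∈ p.support := by
    intro v hv
    rw [show q.support = _ from Walk.support_map .., List.mem_map] at hv
    obtain ⟨w, hw, rfl⟩ := hv
    exact ⟨w.2, hw⟩
  have hqchord : ∀ x ∈ q.support, ∀ y ∈ q.support, G.Adj x y → s(x, y) ∈ q.edges := by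
    intro x hx y hy hxy
    obtain ⟨hxT, hx⟩ := hqT x hx
    obtain ⟨hyT, hy⟩ := hqT y hy
    rw [show q.edges = _ from Walk.edges_map .., List.mem_map]
    exact ⟨_, hchord _ hx _ hy hxy, rfl⟩
  have haq : a ∉ q.support := fun h => haT (hqT a h).1
  have hlen : 2 ≤ q.length := by
    by_contra! hlt
    interval_cases hl : q.length
    · exact hst (Walk.eq_of_length_eq_zero hl)
    · exact hnadj (Walk.adj_of_length_eq_one hl)
  have hcyc : (Walk.cons has (q.concat hat.symm)).IsCycle := by
    rw [Walk.cons_isCycle_iff]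
    refine ⟨hq.concat haq hat.symm, ?_⟩
    rw [Walk.edges_concat, List.concat_eq_append, List.mem_append, List.mem_singleton]
    rintro (h | h)
    · exact haq (q.fst_mem_support_of_mem_edges h)
    · rw [Sym2.eq_swap, Sym2.congr_left] at h
      exact hst h
  obtain ⟨u, v, hu, hv, huv, hne⟩ := hG a _ hcyc (by simp; omega)
  simp only [Walk.support_cons, Walk.support_concat, List.mem_cons, List.mem_append,
    List.mem_nil_iff, or_false, Walk.edges_cons, Walk.edges_concat, List.concat_eq_append,
    not_or] at hu hv hne
  have hmem : ∀ w, (w = a ∨ w ∈ q.support ∨ w = a) → w = a ∨ w ∈ q.support := by tauto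
  have hside : ∀ w ∈ q.support, G.Adj a w → s(a, w) = s(a, s) ∨ s(a, w) = s(t, a) := by
    intro w hw haw
    rcases hT w (hqT w hw).1 haw with rfl | rfl
    · exact .inl rfl
    · exact .inr Sym2.eq_swap
  rcases hmem u hu with rfl | huq <;> rcases hmem v hv with rfl | hvq
  · exact G.irrefl huv
  · have := hside v hvq huv
    tauto
  · have := hside u huq huv.symm
    rw [Sym2.eq_swap] at this
    tauto
  · exact hne.2.1 (hqchord u huq v hvq huv)

/-- A vertex set of a chordal graph containing two distinct nonadjacent vertices is the union of two
proper subsets which meet in a clique and have no further edges between them. -/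
theorem IsChordal.exists_clique_separation (hG : G.IsChordal) [DecidableEq V] {W : Finset V}
    (hW : ¬ G.IsClique (W : Set V)) :
    ∃ A B : Finset V, A ⊂ W ∧ B ⊂ W ∧ (∀ v ∈ W, v ∈ A ∨ v ∈ B) ∧
      (∀ u ∈ W, ∀ v ∈ W, G.Adj u v → (u ∈ A ∧ v ∈ A) ∨ (u ∈ B ∧ v ∈ B)) ∧
      G.IsClique ((A ∩ B : Finset V) : Set V) := by
  classical
  obtain ⟨a, ha, b, hb, hab, hnadj⟩ : ∃ a ∈ W, ∃ b ∈ W, a ≠ b ∧ ¬ G.Adj a b := by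
    simpa [IsClique, Set.Pairwise] using hW
  let U : Set V := {v | v ∈ W ∧ v ≠ a ∧ ¬ G.Adj a v}
  have hbU : b ∈ U := ⟨hb, hab.symm, hnadj⟩
  let K : Set V := {v | ∃ hv : v ∈ U, (G.induce U).Reachable ⟨b, hbU⟩ ⟨v, hv⟩}
  have hKU : ∀ v ∈ K, v ∈ U := fun v hv => hv.1
  have hbK : b ∈ K := ⟨hbU, .rfl⟩
  have hKadj : ∀ c ∈ K, ∀ v ∈ U, G.Adj c v → v ∈ K := by
    rintro c ⟨hc, hr⟩ v hv hcv
    exact ⟨hv, hr.trans (Adj.reachable (G := G.induce U) hcv)⟩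
  let S : Set V := {v | v ∈ W ∧ G.Adj a v ∧ ∃ c ∈ K, G.Adj c v}
  have hboundary : ∀ c ∈ K, ∀ v ∈ W, G.Adj c v → v ∈ K ∨ v ∈ S := by
    intro c hc v hv hcv
    by_cases hav : G.Adj a v
    · exact .inr ⟨hv, hav, c, hc, hcv⟩
    · refine .inl (hKadj c hc v ⟨hv, ?_, hav⟩ hcv)
      rintro rfl
      exact (hKU c hc).2.2 hcv.symm
  have hSK : ∀ v ∈ S, v ∉ K := fun v hv hvK => (hKU v hvK).2.2 hv.2.1
  refine ⟨{v ∈ W | v ∉ K}, {v ∈ W | v ∈ K ∨ v ∈ S}, ?_, ?_, ?_, ?_, ?_⟩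
  · exact Finset.filter_ssubset.2 ⟨b, hb, by simpa using hbK⟩
  · refine Finset.filter_ssubset.2 ⟨a, ha, ?_⟩
    rintro (h | h)
    · exact (hKU a h).2.1 rfl
    · exact G.irrefl h.2.1
  · intro v hv
    simp only [Finset.mem_filter]
    tauto
  · intro u hu v hv huv
    have h₁ := hboundary u
    have h₂ := hboundary v
    have huv' := huv.symm
    simp only [Finset.mem_filter]
    by_cases huK : u ∈ K
    · have := h₁ huK v hv huv
      tauto
    · by_cases hvK : v ∈ K
      · have := h₂ hvK u hu huv'
        tauto
      · tauto
  · intro s hs t ht hst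
    simp only [Finset.coe_inter, Finset.coe_filter, Set.mem_inter_iff, Set.mem_ofPred_eq] at hs ht
    have hsS : s ∈ S := by tauto
    have htS : t ∈ S := by tauto
    obtain ⟨-, has, c, ⟨hcU, hbc⟩, hcs⟩ := hsS
    obtain ⟨-, hat, d, ⟨hdU, hbd⟩, hdt⟩ := htS
    let T : Set V := insert s (insert t U)
    have hUT : U ⊆ T := (Set.subset_insert _ _).trans (Set.subset_insert _ _)
    have hsT : s ∈ T := by simp [T]
    have htT : t ∈ T := by simp [T]
    have hcd : (G.induce T).Reachable ⟨c, hUT hcU⟩ ⟨d, hUT hdU⟩ :=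
      (hbc.symm.trans hbd).map (G.induceHomOfLE hUT).toHom
    have hsc : (G.induce T).Adj ⟨s, hsT⟩ ⟨c, hUT hcU⟩ := hcs.symm
    have hdt' : (G.induce T).Adj ⟨d, hUT hdU⟩ ⟨t, htT⟩ := hdt
    refine hG.adj_of_reachable_induce hsT htT has hat hst ?_ ?_
      (hsc.reachable.trans (hcd.trans hdt'.reachable))
    · rintro (rfl | rfl | h)
      · exact G.irrefl has
      · exact G.irrefl hat
      · exact h.2.1 rfl
    · rintro v (rfl | rfl | h) hav
      · exact .inl rfl
      · exact .inr rfl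
      · exact (h.2.2 hav).elim

theorem IsClique.exists_isMaxClique'_superset [Finite V] {K : Finset V}
    (hK : G.IsClique (K : Set V)) : ∃ D : Finset V, G.IsMaxClique' D ∧ K ⊆ D := by
  obtain ⟨D, hKD, hD⟩ := (Set.toFinite {D : Finset V | G.IsClique (D : Set V)}).exists_le_maximal hK
  exact ⟨D, ⟨hD.prop, fun D' hD' hle => hD.eq_of_le hD' hle⟩, hKD⟩

end SimpleGraph

section Gram

/-- Two families of vectors with the same Gram matrix are related by a linear isometry. -/
theorem exists_linearIsometry_apply_eq_of_inner_eq {ι E : Type*} [NormedAddCommGroup E]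
    [InnerProductSpace ℝ E] [FiniteDimensional ℝ E] {x y : ι → E}
    (h : ∀ i j, ⟪x i, x j⟫_ℝ = ⟪y i, y j⟫_ℝ) : ∃ T : E →ₗᵢ[ℝ] E, ∀ i, T (x i) = y i := by
  let f := Finsupp.linearCombination ℝ x
  let g := Finsupp.linearCombination ℝ y
  have hfg : ∀ c, ‖f c‖ = ‖g c‖ := by
    intro c
    rw [← sq_eq_sq₀ (norm_nonneg _) (norm_nonneg _), ← real_inner_self_eq_norm_sq,
      ← real_inner_self_eq_norm_sq]
    simp only [f, g, Finsupp.linearCombination_apply, Finsupp.sum, sum_inner, inner_sum,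
      real_inner_smul_left, real_inner_smul_right, h]
  obtain ⟨r, hr⟩ := f.rangeRestrict.exists_rightInverse_of_surjective f.range_rangeRestrict
  have hfr : ∀ z, f (r z) = z := fun z => congrArg Subtype.val (LinearMap.congr_fun hr z)
  let L : LinearMap.range f →ₗᵢ[ℝ] E :=
    ⟨g ∘ₗ r, fun z => by rw [LinearMap.comp_apply, ← hfg, hfr, Submodule.coe_norm]⟩
  have hL : ∀ c, L (f.rangeRestrict c) = g c := by
    intro c
    rw [← sub_eq_zero, ← norm_eq_zero]
    change ‖g (r (f.rangeRestrict c)) - g c‖ = 0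
    rw [← map_sub, ← hfg, map_sub, hfr, LinearMap.codRestrict_apply, sub_self, norm_zero]
  refine ⟨L.extend, fun i => ?_⟩
  have hi := hL (Finsupp.single i 1)
  rw [← L.extend_apply] at hi
  simpa [f, g] using hi

variable {V : Type*} [Fintype V] [DecidableEq V]

open scoped MatrixOrder Matrix.Norms.L2Operator in
/-- A matrix with a positive semidefinite principal submatrix on `W` is a Gram matrix on `W`. -/
theorem Matrix.exists_inner_eq_of_posSemidef_submatrix {Q : Matrix V V ℝ} {W : Finset V}
    (hW : (Q.submatrix (Subtype.val : W → V) Subtype.val).PosSemidef) :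
    ∃ x : V → EuclideanSpace ℝ V, ∀ i ∈ W, ∀ j ∈ W, ⟪x i, x j⟫_ℝ = Q i j := by
  obtain ⟨B, hB⟩ := CStarAlgebra.nonneg_iff_eq_star_mul_self.1 hW.nonneg
  refine ⟨fun i => WithLp.toLp 2 fun v =>
    if h : v ∈ W ∧ i ∈ W then B ⟨v, h.1⟩ ⟨i, h.2⟩ else 0, fun i hi j hj => ?_⟩
  have hij := congrFun (congrFun hB ⟨i, hi⟩) ⟨j, hj⟩
  simp only [submatrix_apply, mul_apply, star_eq_conjTranspose, conjTranspose_apply, star_trivial] at hij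
  rw [hij, PiLp.inner_apply, ← Finset.sum_subset (Finset.subset_univ W), ← Finset.sum_attach,
    Finset.attach_eq_univ]
  · refine Finset.sum_congr rfl fun v _ => ?_
    simp [hi, hj, mul_comm]
  · intro v _ hv
    simp [hv]

/-- A matrix that is positive semidefinite on all cliques of a chordal graph inside `W` agrees with
a Gram matrix on the diagonal and edges of the graph inside `W`. -/
theorem SimpleGraph.IsChordal.exists_inner_eq {G : SimpleGraph V} (hG : G.IsChordal)
    {Q : Matrix V V ℝ}
    (hQ : ∀ K : Finset V, G.IsClique (K : Set V) →
      (Q.submatrix (Subtype.val : K → V) Subtype.val).PosSemidef) (W : Finset V) :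
    ∃ x : V → EuclideanSpace ℝ V,
      ∀ i ∈ W, ∀ j ∈ W, (i = j ∨ G.Adj i j) → ⟪x i, x j⟫_ℝ = Q i j := by
  induction W using Finset.strongInduction with
  | H W ih =>
  by_cases hW : G.IsClique (W : Set V)
  · obtain ⟨x, hx⟩ := Matrix.exists_inner_eq_of_posSemidef_submatrix (hQ W hW)
    exact ⟨x, fun i hi j hj _ => hx i hi j hj⟩
  obtain ⟨A, B, hA, hB, hcover, hedge, hclique⟩ := hG.exists_clique_separation hW
  obtain ⟨x, hx⟩ := ih A hA
  obtain ⟨y, hy⟩ := ih B hB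
  obtain ⟨T, hT⟩ := exists_linearIsometry_apply_eq_of_inner_eq
    (x := fun i : {i // i ∈ A ∩ B} => x i) (y := fun i => y i) <| by
      rintro ⟨i, hi⟩ ⟨j, hj⟩
      have hij : i = j ∨ G.Adj i j := or_iff_not_imp_left.2 fun h => hclique hi hj h
      rw [Finset.mem_inter] at hi hj
      exact (hx i hi.1 j hj.1 hij).trans (hy i hi.2 j hj.2 hij).symm
  let z : V → EuclideanSpace ℝ V := fun i => if i ∈ A then T (x i) else y i
  have hzA : ∀ i ∈ A, z i = T (x i) := fun i hi => if_pos hi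
  have hzB : ∀ i ∈ B, z i = y i := by
    intro i hi
    by_cases hiA : i ∈ A
    · rw [hzA i hiA]
      exact hT ⟨i, Finset.mem_inter.2 ⟨hiA, hi⟩⟩
    · exact if_neg hiA
  refine ⟨z, fun i hi j hj hij => ?_⟩
  have hside : (i ∈ A ∧ j ∈ A) ∨ (i ∈ B ∧ j ∈ B) := by
    rcases hij with rfl | hadj
    · simpa using hcover i hi
    · exact hedge i hi j hj hadj
  rcases hside with ⟨hiA, hjA⟩ | ⟨hiB, hjB⟩
  · rw [hzA i hiA, hzA j hjA, T.inner_map_map, hx i hiA j hjA hij]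
  · rw [hzB i hiB, hzB j hjB, hy i hiB j hjB hij]

end Gram

/-- **PSD completion of matrices with chordal sparsity pattern**: if `G` is chordal with maximal
cliques `C₁,…,C_p` and `Q` is symmetric with sparsity pattern `G`, then `Q` has a positive
semidefinite completion iff every principal submatrix `(Q_{ij})_{i,j ∈ C_k}` is positive
semidefinite. -/
theorem chordal_psd_completion (n p : ℕ) (G : SimpleGraph (Fin n))
    (hchordal : G.IsChordal)
    (C : Fin p → Finset (Fin n))
    (hmax : ∀ k, G.IsMaxClique' (C k))
    (hall : ∀ D : Finset (Fin n), G.IsMaxClique' D → ∃ k, D = C k)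
    (Q : Matrix (Fin n) (Fin n) ℝ) (hQsym : Q.IsSymm)
    (hQsp : ∀ i j : Fin n, i ≠ j → ¬ G.Adj i j → Q i j = 0) :
    (∃ Qhat : Matrix (Fin n) (Fin n) ℝ, Qhat.PosSemidef ∧
        ∀ i j : Fin n, (i = j ∨ G.Adj i j) → Qhat i j = Q i j) ↔
      ∀ k : Fin p,
        (Q.submatrix (fun i : {x // x ∈ C k} => (i : Fin n))
          (fun j : {x // x ∈ C k} => (j : Fin n))).PosSemidef := by
  constructor
  · rintro ⟨M, hM, hMQ⟩ k
    convert hM.submatrix (Subtype.val : C k → Fin n) using 1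
    ext i j
    exact (hMQ i j (or_iff_not_imp_left.2 fun h => (hmax k).1 i.2 j.2 h)).symm
  · intro hC
    have hQ : ∀ K : Finset (Fin n), G.IsClique (K : Set (Fin n)) →
        (Q.submatrix (Subtype.val : K → Fin n) Subtype.val).PosSemidef := by
      intro K hK
      obtain ⟨D, hD, hKD⟩ := hK.exists_isMaxClique'_superset
      obtain ⟨k, rfl⟩ := hall D hD
      exact (hC k).submatrix fun i : K => (⟨i, hKD i.2⟩ : C k)
    obtain ⟨x, hx⟩ := hchordal.exists_inner_eq hQ Finset.univ
    exact ⟨Matrix.gram ℝ x, Matrix.posSemidef_gram ℝ x, fun i j hij =>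
      hx i (Finset.mem_univ i) j (Finset.mem_univ j) hij⟩
end

section
/- A connected finite simple graph is chordal if and only if its maximal cliques can be enumerated as C₁,…,C_p so that the running intersection property holds: for every k ∈ {1,…,p−1} there exists i ≤ k such that C_{k+1} ∩ (C₁ ∪ ⋯ ∪ C_k) ⊆ C_i. -/
/-- The running intersection property for a family of finite sets `I 0, …, I (p-1)`:
for every `k < p - 1` there is `l ≤ k` with `I (k+1) ∩ (I 0 ∪ ⋯ ∪ I k) ⊆ I l`. -/
def RIPFinset {α : Type*} [DecidableEq α] {p : ℕ} (I : Fin p → Finset α) : Prop :=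
  ∀ (k : ℕ) (hk : k + 1 < p),
    ∃ l : Fin p, (l : ℕ) ≤ k ∧
      I ⟨k + 1, hk⟩ ∩ (Finset.univ.filter (fun j : Fin p => (j : ℕ) ≤ k)).biUnion I ⊆ I l

namespace SimpleGraph

variable {V : Type*} {G : SimpleGraph V}

/-- A walk whose vertices satisfy `P` can be shortened to a chordless path with the same
endpoints whose vertices satisfy `P`. -/
lemma Walk.exists_isPath_isChordless {u v : V} (P : V → Prop) (p : G.Walk u v)
    (hp : ∀ t ∈ p.support, P t) :
    ∃ q : G.Walk u v, q.IsPath ∧ q.IsChordless ∧ ∀ t ∈ q.support, P t := by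
  classical
  induction hn : p.length using Nat.strong_induction_on generalizing p with
  | _ n ih =>
  subst hn
  by_cases hmin : ∃ q : G.Walk u v, (∀ t ∈ q.support, P t) ∧ q.length < p.length
  · obtain ⟨q, hq, hlt⟩ := hmin
    exact ih _ hlt q hq rfl
  push Not at hmin
  refine ⟨p, ?_, ?_, hp⟩
  · have h1 := hmin p.bypass fun t ht => hp t (p.support_bypass_subset_support ht)
    have h2 : p.bypass = p := p.bypass_eq_self_of_length_le_length_bypass h1
    exact h2 ▸ p.bypass_isPath
  · have key : ∀ i j, i ≤ j → j ≤ p.length → G.Adj (p.getVert i) (p.getVert j) →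
        s(p.getVert i, p.getVert j) ∈ p.edges := by
      intro i j hij hj hadj
      have hne : i ≠ j := by rintro rfl; exact hadj.ne rfl
      have hlen := hmin ((p.take i).append (Walk.cons hadj (p.drop j))) <| by
        intro t ht
        rw [Walk.mem_support_append_iff, Walk.support_cons, List.mem_cons] at ht
        rcases ht with ht | rfl | ht
        · exact hp t ((p.isSubwalk_take i).support_subset ht)
        · exact hp _ (p.getVert_mem_support i)
        · exact hp t ((p.isSubwalk_drop j).support_subset ht)
      simp only [Walk.length_append, Walk.length_cons, Walk.take_length, Walk.drop_length] at hlen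
      have hj' : j = i + 1 := by omega
      subst hj'
      exact p.mk_mem_edges_iff_exists.2 ⟨i, by omega, rfl⟩
    rw [Walk.isChordless_iff_forall_mem_edges]
    intro a b ha hb hab
    obtain ⟨i, rfl, hi⟩ := Walk.mem_support_iff_exists_getVert.1 ha
    obtain ⟨j, rfl, hj⟩ := Walk.mem_support_iff_exists_getVert.1 hb
    rcases le_total i j with h | h
    · exact key i j h hj hab
    · rw [Sym2.eq_swap]
      exact key j i h hi hab.symm

/-- In a chordal graph, two neighbours of `x` joined by a walk with all inner vertices outside the
closed neighbourhood of `x` are adjacent. -/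
lemma IsChordal.adj_of_walk_s3 (hG : G.IsChordal) {x u v : V} (hxu : G.Adj x u) (hxv : G.Adj x v)
    (huv : u ≠ v) (p : G.Walk u v)
    (hp : ∀ t ∈ p.support, t = u ∨ t = v ∨ (t ≠ x ∧ ¬ G.Adj x t)) : G.Adj u v := by
  by_contra hnadj
  obtain ⟨q, hpath, hchord, hq⟩ := p.exists_isPath_isChordless _ hp
  have hxq : x ∉ q.support := by
    intro h
    rcases hq x h with h | h | h
    · exact hxu.ne h
    · exact hxv.ne h
    · exact h.1 rfl
  have hlen : 2 ≤ q.length := by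
    by_contra! h
    have h0 : q.length ≠ 0 := fun h => huv (Walk.eq_of_length_eq_zero h)
    have h1 : q.length = 1 := by omega
    exact hnadj (Walk.adj_of_length_eq_one h1)
  have hcycle : (Walk.cons hxu (q.concat hxv.symm)).IsCycle := by
    rw [Walk.cons_isCycle_iff]
    refine ⟨hpath.concat hxq hxv.symm, ?_⟩
    rw [Walk.edges_concat, List.concat_eq_append, List.mem_append, List.mem_singleton]
    rintro (h | h)
    · exact hxq (q.fst_mem_support_of_mem_edges h)
    · rcases Sym2.eq_iff.1 h with ⟨-, h⟩ | ⟨-, h⟩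
      · exact hxu.ne h.symm
      · exact huv h
  have hedge : ∀ b ∈ q.support, G.Adj x b →
      s(x, b) ∈ (Walk.cons hxu (q.concat hxv.symm)).edges := by
    intro b hb hadj
    rcases hq b hb with rfl | rfl | h
    · simp
    · simp [Walk.edges_concat, Sym2.eq_swap]
    · exact absurd hadj h.2
  have hsupp : ∀ a ∈ (Walk.cons hxu (q.concat hxv.symm)).support, a = x ∨ a ∈ q.support := by
    intro a ha
    simp only [Walk.support_cons, Walk.support_concat, List.mem_cons,
      List.mem_append, List.not_mem_nil, or_false] at ha
    tauto
  obtain ⟨a, b, ha, hb, hab, hnot⟩ := hG x _ hcycle (by simp; omega)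
  apply hnot
  rcases hsupp a ha with rfl | ha' <;> rcases hsupp b hb with rfl | hb'
  · exact absurd rfl hab.ne
  · exact hedge b hb' hab
  · rw [Sym2.eq_swap]
    exact hedge a ha' hab.symm
  · have := hchord.mem_edges ha' hb' hab
    simp [Walk.edges_concat, this]

/-- `z` is simplicial in the subgraph induced on `S`: its neighbours in `S` form a clique. -/
def IsSimplicialIn (G : SimpleGraph V) (S : Finset V) (z : V) : Prop :=
  G.IsClique {a | a ∈ S ∧ G.Adj z a}

/-- In an induced subgraph of a chordal graph, every vertex which is not universal has a
simplicial non-neighbour. -/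
lemma IsChordal.exists_isSimplicialIn_not_adj [DecidableEq V] (hG : G.IsChordal) (S : Finset V) :
    ∀ x ∈ S, ∀ y ∈ S, y ≠ x → ¬ G.Adj x y →
      ∃ z ∈ S, z ≠ x ∧ ¬ G.Adj x z ∧ G.IsSimplicialIn S z := by
  classical
  induction S using Finset.strongInduction with
  | _ S ih =>
  intro x hx y hy hyx hxy
  set T : V → Prop := fun t => t ∈ S ∧ t ≠ x ∧ ¬ G.Adj x t
  set C := S.filter fun z => ∃ p : G.Walk y z, ∀ t ∈ p.support, T t
  set Q := S.filter fun z => z ∉ C ∧ ∃ c ∈ C, G.Adj z c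
  have hCT : ∀ z ∈ C, T z := by
    intro z hz
    obtain ⟨-, p, hp⟩ := Finset.mem_filter.1 hz
    exact hp z p.end_mem_support
  have hyC : y ∈ C := by
    refine Finset.mem_filter.2 ⟨hy, Walk.nil, ?_⟩
    intro t ht
    rw [Walk.support_nil, List.mem_singleton] at ht
    exact ht ▸ ⟨hy, hyx, hxy⟩
  have hQx : ∀ q ∈ Q, G.Adj x q := by
    intro q hq
    obtain ⟨hqS, hqC, c, hc, hadj⟩ := Finset.mem_filter.1 hq
    by_contra hnot
    have hqx : q ≠ x := by
      rintro rfl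
      exact (hCT c hc).2.2 hadj
    obtain ⟨-, p, hp⟩ := Finset.mem_filter.1 hc
    refine hqC (Finset.mem_filter.2 ⟨hqS, p.concat hadj.symm, ?_⟩)
    intro t ht
    rw [Walk.support_concat, List.mem_append, List.mem_singleton] at ht
    rcases ht with ht | rfl
    · exact hp t ht
    · exact ⟨hqS, hqx, hnot⟩
  have hQclique : ∀ u ∈ Q, ∀ v ∈ Q, u ≠ v → G.Adj u v := by
    intro u hu v hv huv
    obtain ⟨-, -, c, hc, huc⟩ := Finset.mem_filter.1 hu
    obtain ⟨-, -, d, hd, hvd⟩ := Finset.mem_filter.1 hv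
    obtain ⟨-, p, hp⟩ := Finset.mem_filter.1 hc
    obtain ⟨-, q, hq⟩ := Finset.mem_filter.1 hd
    refine hG.adj_of_walk_s3 (hQx u hu) (hQx v hv) huv
      (Walk.cons huc ((p.reverse.append q).concat hvd.symm)) ?_
    intro t ht
    simp only [Walk.support_cons, Walk.support_concat, List.mem_cons,
      List.mem_append, Walk.mem_support_append_iff, Walk.support_reverse, List.mem_reverse,
      List.not_mem_nil, or_false] at ht
    rcases ht with h | (h | h) | h
    · exact Or.inl h
    · exact Or.inr (Or.inr (hp t h).2)
    · exact Or.inr (Or.inr (hq t h).2)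
    · exact Or.inr (Or.inl h)
  have hCS : C ⊆ S := Finset.filter_subset _ _
  have hQS : Q ⊆ S := Finset.filter_subset _ _
  have hxC : x ∉ C := fun h => (hCT x h).2.1 rfl
  have hxQ : x ∉ Q := fun h => (hQx x h).ne rfl
  have hHS : C ∪ Q ⊂ S := by
    refine Finset.ssubset_iff_subset_ne.2 ⟨Finset.union_subset hCS hQS, ?_⟩
    intro h
    have : x ∈ C ∪ Q := h ▸ hx
    simp [hxC, hxQ] at this
  have hCS' : C ⊂ S := lt_of_le_of_lt (Finset.subset_union_left) hHS
  suffices h : ∃ z ∈ C, G.IsSimplicialIn (C ∪ Q) z by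
    obtain ⟨z, hz, hsimp⟩ := h
    refine ⟨z, hCS hz, (hCT z hz).2.1, (hCT z hz).2.2, hsimp.subset ?_⟩
    rintro a ⟨ha, hadj⟩
    refine ⟨?_, hadj⟩
    by_cases haC : a ∈ C
    · exact Finset.mem_union_left _ haC
    · exact Finset.mem_union_right _ (Finset.mem_filter.2 ⟨ha, haC, z, hz, hadj.symm⟩)
  by_cases huniv : ∃ q ∈ Q, ∃ h ∈ C ∪ Q, h ≠ q ∧ ¬ G.Adj q h
  · obtain ⟨q, hq, h, hh, hne, hnadj⟩ := huniv
    obtain ⟨z, hz, hzq, hqz, hsimp⟩ := ih _ hHS q (Finset.mem_union_right _ hq) h hh hne hnadj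
    refine ⟨z, ?_, hsimp⟩
    rcases Finset.mem_union.1 hz with hz | hz
    · exact hz
    · exact absurd (hQclique q hq z hz hzq.symm) hqz
  · push Not at huniv
    have hsimpC : ∃ z ∈ C, G.IsSimplicialIn C z := by
      by_cases hcl : ∃ a ∈ C, ∃ b ∈ C, b ≠ a ∧ ¬ G.Adj a b
      · obtain ⟨a, ha, b, hb, hne, hnadj⟩ := hcl
        obtain ⟨z, hz, -, -, hsimp⟩ := ih _ hCS' a ha b hb hne hnadj
        exact ⟨z, hz, hsimp⟩
      · push Not at hcl
        exact ⟨y, hyC, fun a ha b hb hab => hcl a ha.1 b hb.1 hab.symm⟩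
    obtain ⟨z, hz, hsimp⟩ := hsimpC
    refine ⟨z, hz, ?_⟩
    rintro a ⟨ha, hza⟩ b ⟨hb, hzb⟩ hab
    by_cases haQ : a ∈ Q
    · exact huniv a haQ b hb hab.symm
    by_cases hbQ : b ∈ Q
    · exact (huniv b hbQ a ha hab).symm
    have ha' : a ∈ C := (Finset.mem_union.1 ha).resolve_right haQ
    have hb' : b ∈ C := (Finset.mem_union.1 hb).resolve_right hbQ
    exact hsimp ⟨ha', hza⟩ ⟨hb', hzb⟩ hab

/-- Every nonempty induced subgraph of a chordal graph has a simplicial vertex. -/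
lemma IsChordal.exists_isSimplicialIn [DecidableEq V] (hG : G.IsChordal) {S : Finset V}
    (hS : S.Nonempty) : ∃ z ∈ S, G.IsSimplicialIn S z := by
  by_cases hcl : ∃ a ∈ S, ∃ b ∈ S, b ≠ a ∧ ¬ G.Adj a b
  · obtain ⟨a, ha, b, hb, hne, hnadj⟩ := hcl
    obtain ⟨z, hz, -, -, hsimp⟩ := hG.exists_isSimplicialIn_not_adj S a ha b hb hne hnadj
    exact ⟨z, hz, hsimp⟩
  · push Not at hcl
    obtain ⟨y, hy⟩ := hS
    exact ⟨y, hy, fun a ha b hb hab => hcl a ha.1 b hb.1 hab.symm⟩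

/-- `C` is a maximal clique of the subgraph induced on `S`. -/
def IsMaxCliqueIn (G : SimpleGraph V) (S C : Finset V) : Prop :=
  Maximal (fun D : Finset V => D ⊆ S ∧ G.IsClique (D : Set V)) C

lemma exists_isMaxCliqueIn_superset {S K : Finset V} (hKS : K ⊆ S)
    (hK : G.IsClique (K : Set V)) : ∃ C, K ⊆ C ∧ G.IsMaxCliqueIn S C := by
  have hfin : {D : Finset V | D ⊆ S ∧ G.IsClique (D : Set V)}.Finite :=
    (S.powerset.finite_toSet).subset fun D hD => by simpa using hD.1
  obtain ⟨C, hKC, hC⟩ := hfin.exists_le_maximal (a := K) ⟨hKS, hK⟩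
  exact ⟨C, hKC, hC⟩

/-- The maximal cliques after adding a simplicial vertex `v` with neighbourhood `N`. -/
lemma isMaxCliqueIn_iff_of_simplicial [DecidableEq V] {S N : Finset V} {v : V} (hv : v ∈ S)
    (hN : ∀ a, a ∈ N ↔ a ∈ S ∧ G.Adj v a) (hcl : G.IsClique (N : Set V)) (C : Finset V) :
    G.IsMaxCliqueIn S C ↔ C = insert v N ∨ (G.IsMaxCliqueIn (S.erase v) C ∧ C ≠ N) := by
  have hvN : v ∉ N := fun h => ((hN v).1 h).2.ne rfl
  have hins : insert v N ⊆ S ∧ G.IsClique ((insert v N : Finset V) : Set V) := by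
    refine ⟨Finset.insert_subset hv fun a ha => ((hN a).1 ha).1, ?_⟩
    rw [Finset.coe_insert]
    exact hcl.insert fun b hb _ => ((hN b).1 hb).2
  have hle : ∀ D : Finset V, D ⊆ S → G.IsClique (D : Set V) → v ∈ D → D ⊆ insert v N := by
    intro D hDS hD hvD a ha
    by_cases hav : a = v
    · simp [hav]
    · exact Finset.mem_insert_of_mem ((hN a).2 ⟨hDS ha, hD hvD ha (Ne.symm hav)⟩)
  constructor
  · intro hC
    by_cases hvC : v ∈ C
    · exact Or.inl (hC.eq_of_le hins (hle C hC.prop.1 hC.prop.2 hvC))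
    · refine Or.inr ⟨⟨⟨Finset.subset_erase.2 ⟨hC.prop.1, hvC⟩, hC.prop.2⟩, ?_⟩, ?_⟩
      · intro D hD hCD
        exact hC.2 ⟨hD.1.trans (Finset.erase_subset _ _), hD.2⟩ hCD
      · rintro rfl
        exact hvC (hC.2 hins (Finset.subset_insert _ _) (Finset.mem_insert_self _ _))
  · rintro (rfl | ⟨hC, hne⟩)
    · refine ⟨hins, ?_⟩
      intro D hD hle'
      exact hle D hD.1 hD.2 (hle' (Finset.mem_insert_self _ _))
    · refine ⟨⟨hC.prop.1.trans (Finset.erase_subset _ _), hC.prop.2⟩, ?_⟩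
      intro D hD hCD
      by_cases hvD : v ∈ D
      · refine absurd (hC.eq_of_le (y := N) ⟨?_, hcl⟩ ?_) hne
        · exact Finset.subset_erase.2 ⟨fun a ha => ((hN a).1 ha).1, hvN⟩
        · intro a ha
          have hav : a ≠ v := (Finset.mem_erase.1 (hC.prop.1 ha)).1
          exact (Finset.mem_insert.1 (hle D hD.1 hD.2 hvD (hCD ha))).resolve_left hav
      · exact hC.2 ⟨Finset.subset_erase.2 ⟨hD.1, hvD⟩, hD.2⟩ hCD

end SimpleGraph

/-- The running intersection property for a list of finite sets whose last set comes first. -/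
def RIPList {α : Type*} [DecidableEq α] : List (Finset α) → Prop
  | [] => True
  | A :: L => RIPList L ∧ (L = [] ∨ ∃ B ∈ L, ∀ A' ∈ L, A ∩ A' ⊆ B)

/-- Adding a new point `v` to the set `N` preserves the running intersection property. -/
lemma RIPList.map_insert {α : Type*} [DecidableEq α] {v : α} {N : Finset α} :
    ∀ {L : List (Finset α)}, RIPList L → L.Nodup → (∀ A ∈ L, v ∉ A) →
      RIPList (L.map fun A => if A = N then insert v N else A)
  | [], _, _, _ => trivial
  | A :: L, ⟨hL, hA⟩, hnd, hv => by
    rw [List.nodup_cons] at hnd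
    refine ⟨hL.map_insert hnd.2 fun A' hA' => hv A' (List.mem_cons_of_mem _ hA'), ?_⟩
    rcases hA with rfl | ⟨B, hB, hsub⟩
    · exact Or.inl rfl
    · refine Or.inr ⟨_, List.mem_map_of_mem hB, ?_⟩
      intro A'' hA''
      obtain ⟨A', hA', rfl⟩ := List.mem_map.1 hA''
      have hvA := hv A List.mem_cons_self
      have hvA' := hv A' (List.mem_cons_of_mem _ hA')
      have hAA' : A ≠ A' := fun h => hnd.1 (h ▸ hA')
      have hs := hsub A' hA'
      intro t ht
      have hmem : ∀ D : Finset α, t ≠ v →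
          (t ∈ (if D = N then insert v N else D) ↔ t ∈ D) := by
        intro D htv
        split_ifs with h
        · simp [h, htv]
        · rfl
      rw [Finset.mem_inter] at ht
      by_cases htv : t = v
      · subst htv
        exfalso
        by_cases hAN : A = N
        · rw [if_neg fun h => hAA' (hAN.trans h.symm)] at ht
          exact hvA' ht.2
        · exact hvA (by simpa only [if_neg hAN] using ht.1)
      · rw [hmem _ htv, hmem _ htv] at ht
        exact (hmem _ htv).2 (hs (Finset.mem_inter.2 ht))

lemma RIPList.exists_index {α : Type*} [DecidableEq α] :
    ∀ {L : List (Finset α)}, RIPList L → ∀ i, (hi : i + 1 < L.length) →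
      ∃ j, ∃ hj : j < L.length, i < j ∧
        ∀ k, (hk : k < L.length) → i < k → L[i] ∩ L[k] ⊆ L[j]
  | [], _, i, hi => by simp at hi
  | A :: L, ⟨hL, hA⟩, 0, hi => by
    rcases hA with rfl | ⟨B, hB, hsub⟩
    · simp at hi
    · obtain ⟨j, hj, rfl⟩ := List.mem_iff_getElem.1 hB
      refine ⟨j + 1, by simpa using hj, by omega, ?_⟩
      intro k hk hpos
      obtain ⟨k, rfl⟩ := Nat.exists_eq_succ_of_ne_zero hpos.ne'
      simpa using hsub _ (List.getElem_mem (by simpa using hk))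
  | A :: L, ⟨hL, hA⟩, i + 1, hi => by
    obtain ⟨j, hj, hij, hsub⟩ := hL.exists_index i (by simpa using hi)
    refine ⟨j + 1, by simpa using hj, by omega, ?_⟩
    intro k hk hpos
    obtain ⟨k, rfl⟩ := Nat.exists_eq_succ_of_ne_zero (Nat.ne_of_gt (Nat.zero_lt_of_lt hpos))
    simpa using hsub k (by simpa using hk) (by omega)

lemma RIPList.ripFinset {α : Type*} [DecidableEq α] {L : List (Finset α)} (hL : RIPList L) :
    RIPFinset fun i : Fin L.length => L[i.rev] := by
  intro k hk
  obtain ⟨j, hj, hij, hsub⟩ := hL.exists_index (L.length - (k + 1 + 1)) (by omega)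
  refine ⟨Fin.rev ⟨j, hj⟩, by simp; omega, ?_⟩
  intro t ht
  rw [Finset.mem_inter, Finset.mem_biUnion] at ht
  obtain ⟨ht1, m, hm, ht2⟩ := ht
  have hm' : (m : ℕ) ≤ k := (Finset.mem_filter.1 hm).2
  have := hsub (m.rev : ℕ) m.rev.2 (by simp; omega)
  have h3 := this (Finset.mem_inter.2 ⟨by simpa using ht1, by simpa using ht2⟩)
  simpa using h3

/-- The maximal cliques of an induced subgraph of a chordal graph can be listed with the running
intersection property. -/
lemma SimpleGraph.IsChordal.exists_ripList {V : Type*} [DecidableEq V] {G : SimpleGraph V}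
    (hG : G.IsChordal) (S : Finset V) :
    ∃ L : List (Finset V), L.Nodup ∧ (∀ C, C ∈ L ↔ G.IsMaxCliqueIn S C) ∧ RIPList L := by
  classical
  induction S using Finset.strongInduction with
  | _ S ih =>
  rcases S.eq_empty_or_nonempty with rfl | hne
  · refine ⟨[∅], by simp, ?_, trivial, Or.inl rfl⟩
    intro C
    rw [List.mem_singleton]
    constructor
    · rintro rfl
      exact ⟨⟨subset_rfl, by simp⟩, fun D hD _ => hD.1⟩
    · intro hC
      exact Finset.subset_empty.1 hC.prop.1
  obtain ⟨v, hv, hsimp⟩ := hG.exists_isSimplicialIn hne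
  obtain ⟨L, hnd, hL, hrip⟩ := ih _ (Finset.erase_ssubset hv)
  set N := S.filter (G.Adj v)
  have hN : ∀ a, a ∈ N ↔ a ∈ S ∧ G.Adj v a := fun a => Finset.mem_filter
  have hNcl : G.IsClique (N : Set V) := hsimp.subset fun a ha => (hN a).1 ha
  have hmax := isMaxCliqueIn_iff_of_simplicial hv hN hNcl
  have hvL : ∀ A ∈ L, v ∉ A := fun A hA hvA =>
    (Finset.mem_erase.1 (((hL A).1 hA).prop.1 hvA)).1 rfl
  by_cases hNL : N ∈ L
  · refine ⟨_, ?_, ?_, hrip.map_insert (N := N) hnd hvL⟩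
    · refine List.Nodup.map_on ?_ hnd
      intro A hA B hB hAB
      have hvA := hvL A hA
      have hvB := hvL B hB
      split_ifs at hAB with h1 h2 h2
      · exact h1.trans h2.symm
      · exact absurd (hAB ▸ Finset.mem_insert_self v N) hvB
      · exact absurd (hAB ▸ Finset.mem_insert_self v N) hvA
      · exact hAB
    · intro C
      rw [hmax, ← hL, List.mem_map]
      constructor
      · rintro ⟨A, hA, rfl⟩
        split_ifs with h
        · exact Or.inl rfl
        · exact Or.inr ⟨hA, h⟩
      · rintro (rfl | ⟨hC, hne⟩)
        · exact ⟨N, hNL, if_pos rfl⟩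
        · exact ⟨C, hC, if_neg hne⟩
  · refine ⟨insert v N :: L, ?_, ?_, hrip, Or.inr ?_⟩
    · exact List.nodup_cons.2 ⟨fun h => hvL _ h (Finset.mem_insert_self _ _), hnd⟩
    · intro C
      rw [hmax, ← hL, List.mem_cons]
      refine or_congr_right ⟨fun h => ⟨h, ?_⟩, fun h => h.1⟩
      rintro rfl
      exact hNL h
    · obtain ⟨B, hNB, hB⟩ := exists_isMaxCliqueIn_superset (S := S.erase v) (K := N)
        (fun a ha => Finset.mem_erase.2 ⟨((hN a).1 ha).2.ne', ((hN a).1 ha).1⟩) hNcl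
      refine ⟨B, (hL B).2 hB, ?_⟩
      intro A hA t ht
      rw [Finset.mem_inter, Finset.mem_insert] at ht
      rcases ht with ⟨rfl | ht, htA⟩
      · exact absurd htA (hvL A hA)
      · exact hNB ht

/-- If the sets of a family with the running intersection property cover a pair of points, and `m`
is the first index of a set containing the first point, at or after the first index of a set
containing the second one, then the `m`-th set contains the second point. -/
lemma RIPFinset.mem_of_first {α : Type*} [DecidableEq α] {p : ℕ} {I : Fin p → Finset α}
    (hI : RIPFinset I) {x a : α} {m f : Fin p} (hm : ∀ j, x ∈ I j → m ≤ j) (hxm : x ∈ I m)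
    (hf : a ∈ I f) (hfm : f ≤ m) :
    ∀ j : Fin p, x ∈ I j → a ∈ I j → a ∈ I m := by
  intro j
  induction hn : (j : ℕ) using Nat.strong_induction_on generalizing j with
  | _ n ih =>
  subst hn
  intro hxj haj
  rcases (hm j hxj).eq_or_lt with rfl | hlt
  · exact haj
  obtain ⟨k, hk⟩ := Nat.exists_eq_succ_of_ne_zero (Nat.ne_of_gt (Nat.zero_lt_of_lt hlt))
  have hlt' : (m : ℕ) < j := hlt
  have hfm' : (f : ℕ) ≤ m := hfm
  obtain ⟨l, hl, hsub⟩ := hI k (by omega)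
  have hj : (⟨k + 1, by omega⟩ : Fin p) = j := Fin.ext hk.symm
  rw [hj] at hsub
  refine ih l (by omega) l rfl (hsub ?_) (hsub ?_)
  · refine Finset.mem_inter.2 ⟨hxj, Finset.mem_biUnion.2 ⟨m, ?_, hxm⟩⟩
    simp; omega
  · refine Finset.mem_inter.2 ⟨haj, Finset.mem_biUnion.2 ⟨f, ?_, hf⟩⟩
    simp; omega

/-- In a cycle of length at least four the two neighbours of the base point are not joined by an
edge of the cycle. -/
lemma SimpleGraph.Walk.IsCycle.snd_penultimate_notMem_edges {V : Type*} {G : SimpleGraph V} {v : V}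
    {w : G.Walk v v} (hw : w.IsCycle) (hlen : 4 ≤ w.length) :
    s(w.snd, w.penultimate) ∉ w.edges := by
  intro h
  have hinj : ∀ i j, 1 ≤ i → i ≤ w.length → 1 ≤ j → j ≤ w.length →
      w.getVert i = w.getVert j → i = j := fun i j h1 h2 h3 h4 h =>
    hw.getVert_injOn ⟨h1, h2⟩ ⟨h3, h4⟩ h
  obtain ⟨i, hi, he⟩ := w.mk_mem_edges_iff_exists.1 h
  have hi1 : ∃ i', 1 ≤ i' ∧ i' ≤ w.length ∧ w.getVert i = w.getVert i' ∧
      (i' = i ∨ (i = 0 ∧ i' = w.length)) := by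
    rcases Nat.eq_zero_or_pos i with rfl | hpos
    · exact ⟨w.length, by omega, le_rfl, by simp, Or.inr ⟨rfl, rfl⟩⟩
    · exact ⟨i, hpos, by omega, rfl, Or.inl rfl⟩
  obtain ⟨i', h1, h2, h3, h4⟩ := hi1
  rw [h3] at he
  rcases Sym2.eq_iff.1 he.symm with ⟨ha, hb⟩ | ⟨ha, hb⟩
  · have := hinj 1 i' le_rfl (by omega) h1 h2 ha
    have := hinj (w.length - 1) (i + 1) (by omega) (by omega) (by omega) (by omega) hb
    omega
  · have := hinj 1 (i + 1) le_rfl (by omega) (by omega) (by omega) ha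
    have := hinj (w.length - 1) i' (by omega) (by omega) h1 h2 hb
    omega

/-- A graph is chordal if some family of cliques covering all its vertices and edges has the
running intersection property. -/
lemma RIPFinset.isChordal {V : Type*} [DecidableEq V] {G : SimpleGraph V} {p : ℕ}
    {C : Fin p → Finset V} (hC : ∀ k, G.IsClique (C k : Set V))
    (hvert : ∀ x, ∃ k, x ∈ C k) (hedge : ∀ x y, G.Adj x y → ∃ k, x ∈ C k ∧ y ∈ C k)
    (hrip : RIPFinset C) : G.IsChordal := by
  have hfirst : ∀ x, ∃ m, x ∈ C m ∧ ∀ j, x ∈ C j → m ≤ j := by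
    intro x
    obtain ⟨m, hm⟩ := (Set.toFinite {k | x ∈ C k}).exists_minimal (hvert x)
    exact ⟨m, hm.prop, fun j hj => (le_total m j).elim id fun h => hm.2 hj h⟩
  choose f hf hmin using hfirst
  intro v w hw hlen
  obtain ⟨x, hx, hxmax⟩ := w.support.toFinset.exists_max_image f ⟨v, by simp⟩
  rw [List.mem_toFinset] at hx
  have hnbr : ∀ a ∈ w.support, G.Adj x a → a ∈ C (f x) := by
    intro a ha hxa
    obtain ⟨j, hxj, haj⟩ := hedge x a hxa
    exact hrip.mem_of_first (hmin x) (hf x) (hf a) (hxmax a (by simpa using ha)) j hxj haj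
  set c := w.rotate x hx with hc
  have hcyc : c.IsCycle := hw.rotate hx
  have hsupp : ∀ a, a ∈ c.support → a ∈ w.support :=
    fun a ha => (w.mem_support_rotate_iff x hx).1 ha
  have h1 : c.snd ∈ w.support := hsupp _ (c.getVert_mem_support _)
  have h2 : c.penultimate ∈ w.support := hsupp _ (c.getVert_mem_support _)
  refine ⟨c.snd, c.penultimate, h1, h2, ?_, ?_⟩
  · exact hC (f x) (hnbr _ h1 (c.adj_snd hcyc.not_nil))
      (hnbr _ h2 (c.adj_penultimate hcyc.not_nil).symm) hcyc.snd_ne_penultimate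
  · intro h
    exact hcyc.snd_penultimate_notMem_edges (by simpa [hc] using hlen)
      ((w.rotate_edges x hx).perm.mem_iff.2 h)

lemma SimpleGraph.isMaxCliqueIn_univ_iff {V : Type*} [Fintype V] {G : SimpleGraph V}
    {C : Finset V} : G.IsMaxCliqueIn Finset.univ C ↔ G.IsMaxClique' C := by
  constructor
  · intro h
    exact ⟨h.prop.2, fun D hD hCD => h.eq_of_le ⟨D.subset_univ, hD⟩ hCD⟩
  · intro h
    exact ⟨⟨C.subset_univ, h.1⟩, fun D hD hCD => (h.2 D hD.2 hCD).ge⟩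

/-- **A connected finite simple graph is chordal iff its maximal cliques can be enumerated so
that the running intersection property holds.** -/
theorem chordal_iff_rip (V : Type*) [Fintype V] [DecidableEq V]
    (G : SimpleGraph V) (hconn : G.Connected) :
    G.IsChordal ↔
      ∃ (p : ℕ) (C : Fin p → Finset V),
        Function.Injective C ∧
        (∀ k, G.IsMaxClique' (C k)) ∧
        (∀ D : Finset V, G.IsMaxClique' D → ∃ k, D = C k) ∧
        RIPFinset C := by
  constructor
  · intro hG
    obtain ⟨L, hnd, hL, hrip⟩ := hG.exists_ripList Finset.univ
    refine ⟨L.length, fun i => L[i.rev], ?_, ?_, ?_, hrip.ripFinset⟩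
    · intro i j hij
      exact Fin.rev_injective (Fin.ext ((List.Nodup.getElem_inj_iff hnd).1 hij))
    · intro k
      exact SimpleGraph.isMaxCliqueIn_univ_iff.1 ((hL _).1 (List.getElem_mem _))
    · intro D hD
      obtain ⟨i, hi, rfl⟩ := List.mem_iff_getElem.1 ((hL D).2 (SimpleGraph.isMaxCliqueIn_univ_iff.2 hD))
      exact ⟨Fin.rev ⟨i, hi⟩, by simp⟩
  · rintro ⟨p, C, -, hmax, hall, hrip⟩
    have hcover : ∀ K : Finset V, G.IsClique (K : Set V) → ∃ k, K ⊆ C k := by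
      intro K hK
      obtain ⟨D, hKD, hD⟩ := G.exists_isMaxCliqueIn_superset K.subset_univ hK
      obtain ⟨k, rfl⟩ := hall D (SimpleGraph.isMaxCliqueIn_univ_iff.1 hD)
      exact ⟨k, hKD⟩
    refine hrip.isChordal (fun k => (hmax k).1) ?_ ?_
    · intro x
      obtain ⟨k, hk⟩ := hcover {x} (by simp)
      exact ⟨k, hk (by simp)⟩
    · intro x y hxy
      obtain ⟨k, hk⟩ := hcover {x, y} (by simpa [SimpleGraph.isClique_pair] using fun _ => hxy)
      exact ⟨k, hk (by simp), hk (by simp)⟩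
end

section
/- Gluing lemma for measures with overlapping marginals: let I₁,…,I_p ⊆ {1,…,n} with I₁ ∪ ⋯ ∪ I_p = {1,…,n}, for each k let X_k ⊆ ℝ^{I_k} be a compact set, and let X = {x ∈ ℝⁿ : the restriction of x to the coordinates in I_k lies in X_k for every k}. Suppose μ₁,…,μ_p are Borel probability measures, with μ_k a measure on ℝ^{I_k} vanishing outside X_k, such that for every pair j,k with I_j ∩ I_k ≠ ∅, the pushforward of μ_j under coordinate restriction to ℝ^{I_j∩I_k} equals the pushforward of μ_k under coordinate restriction to ℝ^{I_j∩I_k}. If I₁,…,I_p satisfy the running intersection property, then there exists a Borel probability measure μ on ℝⁿ vanishing outside X such that for every k the pushforward of μ under coordinate restriction to ℝ^{I_k} equals μ_k. -/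
open MeasureTheory

/-- Two probability measures with the same image in a common space `C` have a coupling
concentrated on the fibre product over `C`. -/
theorem exists_coupling_of_map_eq {A B C : Type*} [MeasurableSpace A] [MeasurableSpace B]
    [StandardBorelSpace B] [Nonempty B] [MeasurableSpace C] [MeasurableEq C]
    (ρ : Measure A) [IsProbabilityMeasure ρ] (σ : Measure B) [IsProbabilityMeasure σ]
    {f : A → C} {g : B → C} (hf : Measurable f) (hg : Measurable g)
    (h : ρ.map f = σ.map g) :
    ∃ π : Measure (A × B), IsProbabilityMeasure π ∧ π.map Prod.fst = ρ ∧ π.map Prod.snd = σ ∧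
      ∀ᵐ x ∂π, f x.1 = g x.2 := by
  let κ : ProbabilityTheory.Kernel C B := ProbabilityTheory.condDistrib id g σ
  let π : Measure (A × B) := ρ.compProd (κ.comap f hf)
  have hfid : Measurable (Prod.map f id : A × B → C × B) := hf.prodMap measurable_id
  have hgid : Measurable (fun b : B => (g b, b)) := hg.prodMk measurable_id
  have hπ : π.map (Prod.map f id) = σ.map (fun b => (g b, b)) := by
    have hκ : (σ.map g).compProd κ = σ.map (fun b => (g b, b)) :=
      ProbabilityTheory.compProd_map_condDistrib aemeasurable_id
    rw [← hκ, ← h]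
    ext s hs
    rw [Measure.map_apply hfid hs, Measure.compProd_apply (hfid hs),
      Measure.compProd_apply hs,
      lintegral_map (ProbabilityTheory.Kernel.measurable_kernel_prodMk_left hs) hf]
    rfl
  refine ⟨π, inferInstance, Measure.fst_compProd ρ _, ?_, ?_⟩
  · have hsnd := congrArg (Measure.map Prod.snd) hπ
    rw [Measure.map_map measurable_snd hfid, Measure.map_map measurable_snd hgid] at hsnd
    exact hsnd.trans Measure.map_id
  · have hd : MeasurableSet {y : C × B | y.1 = g y.2} :=
      measurableSet_eq_fun measurable_fst (hg.comp measurable_snd)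
    have hmap : ∀ᵐ y ∂π.map (Prod.map f id), y.1 = g y.2 := by
      rw [hπ, ae_map_iff hgid.aemeasurable hd]
      exact .of_forall fun _ => rfl
    exact (ae_map_iff hfid.aemeasurable hd).1 hmap

/-- A measure `ρ` on `ℝ^ι` and a measure `σ` on `ℝ^T` with the same marginal on `S ⊆ T` can be
replaced by a single measure with marginal `σ` on `T` and the marginals of `ρ` on all sets
meeting `T` only inside `S`. -/
theorem exists_measure_glue_marginal {ι : Type*} [Fintype ι] [DecidableEq ι]
    (ρ : Measure (ι → ℝ)) [IsProbabilityMeasure ρ] {S T : Finset ι} (hST : S ⊆ T)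
    (σ : Measure ({i // i ∈ T} → ℝ)) [IsProbabilityMeasure σ]
    (h : ρ.map (fun x (i : {i // i ∈ S}) => x i.1) =
      σ.map (fun y (i : {i // i ∈ S}) => y ⟨i.1, hST i.2⟩)) :
    ∃ ρ' : Measure (ι → ℝ), IsProbabilityMeasure ρ' ∧
      ρ'.map (fun x (i : {i // i ∈ T}) => x i.1) = σ ∧
      ∀ U : Finset ι, U ∩ T ⊆ S →
        ρ'.map (fun x (i : {i // i ∈ U}) => x i.1) =
          ρ.map (fun x (i : {i // i ∈ U}) => x i.1) := by
  obtain ⟨π, hπ, hfst, hsnd, hae⟩ :=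
    exists_coupling_of_map_eq ρ σ (by fun_prop) (by fun_prop) h
  let F : (ι → ℝ) × ({i // i ∈ T} → ℝ) → ι → ℝ :=
    fun z i => if hi : i ∈ T then z.2 ⟨i, hi⟩ else z.1 i
  have hF : Measurable F := by
    refine measurable_pi_lambda _ fun i => ?_
    by_cases hi : i ∈ T
    · simp only [F, hi, dite_true]
      fun_prop
    · simp only [F, hi, dite_false]
      fun_prop
  have hres (U : Finset ι) : Measurable (fun (x : ι → ℝ) (i : {i // i ∈ U}) => x i.1) := by
    fun_prop
  refine ⟨π.map F, Measure.isProbabilityMeasure_map hF.aemeasurable, ?_, fun U hU => ?_⟩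
  · rw [Measure.map_map (hres T) hF, ← hsnd]
    congr 1
    ext z i
    simp [F]
  · rw [Measure.map_map (hres U) hF, ← hfst, Measure.map_map (hres U) measurable_fst]
    refine Measure.map_congr ?_
    filter_upwards [hae] with z hz
    ext i
    by_cases hi : i.1 ∈ T
    · have := congrFun hz ⟨i.1, hU (Finset.mem_inter.2 ⟨i.2, hi⟩)⟩
      simpa [F, hi] using this.symm
    · simp [F, hi]

/-- Probability measures on a subsingleton agree. -/
theorem probabilityMeasure_eq_of_subsingleton {C : Type*} [MeasurableSpace C] [Subsingleton C]
    (ρ σ : Measure C) [IsProbabilityMeasure ρ] [IsProbabilityMeasure σ] : ρ = σ := by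
  ext s -
  rcases Set.eq_empty_or_nonempty s with rfl | hs
  · simp
  · rw [Set.Nonempty.eq_univ hs, measure_univ, measure_univ]

/-- **Gluing lemma for measures with overlapping marginals**: given compact sets
`X_k ⊆ ℝ^{I_k}` and probability measures `μ_k` on `ℝ^{I_k}` vanishing outside `X_k` whose
pairwise marginals on overlapping coordinates agree, if `I₁,…,I_p` satisfies the running
intersection property then there is a probability measure `μ` on `ℝⁿ`, vanishing outside
`X = {x : x|_{I_k} ∈ X_k for all k}`, whose marginal on every `ℝ^{I_k}` is `μ_k`. -/
theorem gluing_measures_RIP (n p : ℕ) (I : Fin p → Finset (Fin n))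
    (hcover : ∀ i : Fin n, ∃ k, i ∈ I k)
    (hRIP : RIPFinset I)
    (Xk : ∀ k : Fin p, Set ({i // i ∈ I k} → ℝ))
    (hXc : ∀ k, IsCompact (Xk k))
    (μ : ∀ k : Fin p, Measure ({i // i ∈ I k} → ℝ))
    (hprob : ∀ k, IsProbabilityMeasure (μ k))
    (hout : ∀ k, μ k ((Xk k)ᶜ) = 0)
    (hmarg : ∀ j k : Fin p, (I j ∩ I k).Nonempty →
      Measure.map
          (fun (y : {i // i ∈ I j} → ℝ) (i : {i // i ∈ I j ∩ I k}) =>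
            y ⟨i.1, (Finset.mem_inter.mp i.2).1⟩) (μ j) =
        Measure.map
          (fun (y : {i // i ∈ I k} → ℝ) (i : {i // i ∈ I j ∩ I k}) =>
            y ⟨i.1, (Finset.mem_inter.mp i.2).2⟩) (μ k)) :
    ∃ μ0 : Measure (Fin n → ℝ),
      IsProbabilityMeasure μ0 ∧
      μ0 ({x : Fin n → ℝ | ∀ k : Fin p, (fun i : {i // i ∈ I k} => x i.1) ∈ Xk k}ᶜ) = 0 ∧
      ∀ k : Fin p,
        Measure.map (fun (x : Fin n → ℝ) (i : {i // i ∈ I k}) => x i.1) μ0 = μ k := by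
  have hres (U : Finset (Fin n)) :
      Measurable (fun (x : Fin n → ℝ) (i : {i // i ∈ U}) => x i.1) := by fun_prop
  have key : ∀ m ≤ p, ∃ ρ : Measure (Fin n → ℝ), IsProbabilityMeasure ρ ∧
      ∀ k : Fin p, (k : ℕ) < m →
        ρ.map (fun (x : Fin n → ℝ) (i : {i // i ∈ I k}) => x i.1) = μ k := by
    intro m
    induction m with
    | zero => exact fun _ => ⟨Measure.dirac 0, inferInstance, fun k hk => absurd hk (by omega)⟩
    | succ m ih =>
      intro hm
      obtain ⟨ρ, hρ, hρm⟩ := ih (by omega)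
      let q : Fin p := ⟨m, hm⟩
      obtain ⟨S, hSq, hS, hSint⟩ : ∃ (S : Finset (Fin n)) (hSq : S ⊆ I q),
          ρ.map (fun x (i : {i // i ∈ S}) => x i.1) =
            (μ q).map (fun y (i : {i // i ∈ S}) => y ⟨i.1, hSq i.2⟩) ∧
          ∀ j : Fin p, (j : ℕ) < m → I j ∩ I q ⊆ S := by
        have hempty : ρ.map (fun x (i : {i // i ∈ (∅ : Finset (Fin n))}) => x i.1) =
            (μ q).map (fun y (i : {i // i ∈ (∅ : Finset (Fin n))}) =>
              y ⟨i.1, Finset.empty_subset _ i.2⟩) := by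
          have := hprob q
          have := Measure.isProbabilityMeasure_map (μ := ρ) (hres ∅).aemeasurable
          have := Measure.isProbabilityMeasure_map (μ := μ q)
            (f := fun y (i : {i // i ∈ (∅ : Finset (Fin n))}) =>
              y ⟨i.1, Finset.empty_subset _ i.2⟩) (Measurable.aemeasurable (by fun_prop))
          exact probabilityMeasure_eq_of_subsingleton _ _
        rcases m with _ | m
        · exact ⟨∅, Finset.empty_subset _, hempty, fun j hj => absurd hj (by omega)⟩
        obtain ⟨l, hl, hlsub⟩ := hRIP m hm
        have hint (j : Fin p) (hj : (j : ℕ) < m + 1) : I j ∩ I q ⊆ I l ∩ I q := fun i hi => by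
          obtain ⟨hij, hiq⟩ := Finset.mem_inter.1 hi
          refine Finset.mem_inter.2 ⟨hlsub (Finset.mem_inter.2 ⟨hiq, ?_⟩), hiq⟩
          exact Finset.mem_biUnion.2
            ⟨j, Finset.mem_filter.2 ⟨Finset.mem_univ _, by omega⟩, hij⟩
        rcases (I l ∩ I q).eq_empty_or_nonempty with he | hne
        · exact ⟨∅, Finset.empty_subset _, hempty, fun j hj => he ▸ hint j hj⟩
        · refine ⟨I l ∩ I q, Finset.inter_subset_right, ?_, hint⟩
          rw [← hmarg l q hne, ← hρm l (by omega), Measure.map_map (by fun_prop) (hres _)]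
          rfl
      have := hprob q
      obtain ⟨ρ', hρ', hT, hU⟩ := exists_measure_glue_marginal ρ hSq (μ q) hS
      refine ⟨ρ', hρ', fun k hk => ?_⟩
      rcases Nat.lt_succ_iff_lt_or_eq.1 hk with hk | hk
      · rw [hU _ (hSint k hk), hρm k hk]
      · obtain rfl : k = q := Fin.ext hk
        exact hT
  obtain ⟨ρ, hρ, hρm⟩ := key p le_rfl
  refine ⟨ρ, hρ, ?_, fun k => hρm k k.2⟩
  rw [← mem_ae_iff]
  refine (ae_all_iff (p := fun (x : Fin n → ℝ) k => (fun i : {i // i ∈ I k} => x i.1) ∈ Xk k)).2 fun k => ?_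
  refine (ae_map_iff (hres (I k)).aemeasurable (hXc k).isClosed.measurableSet).1 ?_
  rw [hρm k k.2]
  exact hout k
end

section
/- Correlatively sparse measure reformulation of polynomial optimization: let f, g₁,…,g_m ∈ ℝ[x₁,…,xₙ] and X = {x ∈ ℝⁿ : g₁(x) ≥ 0, …, g_m(x) ≥ 0}, assumed nonempty. Assume: (i) there are sets I₁,…,I_p ⊆ {1,…,n} covering {1,…,n} and polynomials f₁,…,f_p with f = f₁ + ⋯ + f_p and f_k ∈ ℝ[x,I_k]; (ii) {1,…,m} is partitioned into J₁,…,J_p with g_j ∈ ℝ[x,I_k] for every j ∈ J_k; (iii) I₁,…,I_p satisfy the running intersection property; (iv) for every k there exist N_k > 0 and j ∈ J_k with g_j = N_k − Σ_{i∈I_k} xᵢ². For each k set X_k = {y ∈ ℝ^{I_k} : g_j(y) ≥ 0 for all j ∈ J_k}. Then the infimum, over all tuples (μ₁,…,μ_p) of Borel probability measures with μ_k a measure on ℝ^{I_k} vanishing outside X_k and such that for every pair j,k with I_j ∩ I_k ≠ ∅ the pushforwards of μ_j and of μ_k under coordinate restriction to ℝ^{I_j∩I_k} coincide, of Σ_{k=1}^p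 ∫ f_k dμ_k, equals the minimum of f over X. -/
open MeasureTheory MvPolynomial

/-- Extension by zero of a point of `ℝ^s` to a point of `ℝⁿ`; composing with it identifies a
polynomial in the variables of `s` with a polynomial function on `ℝ^s`. -/
def extZero {n : ℕ} (s : Finset (Fin n)) (y : {i // i ∈ s} → ℝ) : Fin n → ℝ :=
  fun i => if h : i ∈ s then y ⟨i, h⟩ else 0

/-- Two probability measures with the same image under `a` and `b` admit a coupling
concentrated on the fibre product `{(x, y) | a x = b y}`. -/
theorem exists_coupling_of_map_eq_s5 {E F S : Type*} [MeasurableSpace E] [MeasurableSpace F]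
    [StandardBorelSpace F] [Nonempty F] [MeasurableSpace S] [MeasurableEq S]
    (ν : Measure E) [IsProbabilityMeasure ν] (μ : Measure F) [IsProbabilityMeasure μ]
    {a : E → S} {b : F → S} (ha : Measurable a) (hb : Measurable b) (h : ν.map a = μ.map b) :
    ∃ ρ : Measure (E × F), IsProbabilityMeasure ρ ∧ ρ.map Prod.fst = ν ∧ ρ.map Prod.snd = μ ∧
      ∀ᵐ z ∂ρ, a z.1 = b z.2 := by
  let κ := ProbabilityTheory.condDistrib (id : F → F) b μ
  let ρ := ν.compProd (κ.comap a ha)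
  have hκ : (μ.map b).compProd κ = μ.map fun y => (b y, y) :=
    ProbabilityTheory.compProd_map_condDistrib aemeasurable_id
  have hρ : ρ.map (fun z => (a z.1, z.2)) = μ.map fun y => (b y, y) := by
    rw [← hκ, ← h]
    ext s hs
    have hm : Measurable fun z : E × F => (a z.1, z.2) := by fun_prop
    rw [Measure.map_apply hm hs, Measure.compProd_apply (hm hs), Measure.compProd_apply hs,
      lintegral_map (ProbabilityTheory.Kernel.measurable_kernel_prodMk_left hs) ha]
    rfl
  refine ⟨ρ, inferInstance, Measure.fst_compProd _ _, ?_, ?_⟩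
  · have := congrArg (Measure.map Prod.snd) hρ
    rw [Measure.map_map (by fun_prop) (by fun_prop),
      Measure.map_map (by fun_prop) (by fun_prop)] at this
    simpa [Function.comp_def] using this
  · have hm : Measurable fun z : E × F => (a z.1, z.2) := by fun_prop
    have hs : MeasurableSet {w : S × F | w.1 = b w.2} :=
      measurableSet_eq_fun measurable_fst (hb.comp measurable_snd)
    refine (ae_map_iff hm.aemeasurable hs).1 ?_
    rw [hρ, ae_map_iff (by fun_prop) hs]
    simp

/-- A probability measure on a product space can be modified so as to have a prescribed marginal
on `s`, without changing its marginals on sets `t` with `t ∩ s ⊆ T`, as long as it already has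
the prescribed marginal on `T ⊆ s`. -/
theorem exists_measure_extend_marginal {ι : Type*} [DecidableEq ι] {s T : Finset ι}
    (hT : T ⊆ s) (ν : Measure (ι → ℝ)) [IsProbabilityMeasure ν]
    (μ : Measure ((i : s) → ℝ)) [IsProbabilityMeasure μ]
    (h : ν.map T.restrict = μ.map (Finset.restrict₂ (π := fun _ => ℝ) hT)) :
    ∃ ν' : Measure (ι → ℝ), IsProbabilityMeasure ν' ∧ ν'.map s.restrict = μ ∧
      ∀ t : Finset ι, t ∩ s ⊆ T → ν'.map t.restrict = ν.map t.restrict := by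
  obtain ⟨ρ, hρ, h1, h2, hae⟩ := exists_coupling_of_map_eq_s5 ν μ
    (Finset.measurable_restrict T) (Finset.measurable_restrict₂ hT) h
  let e : (ι → ℝ) × ((i : s) → ℝ) → ι → ℝ :=
    fun z i => if hi : i ∈ s then z.2 ⟨i, hi⟩ else z.1 i
  have he : Measurable e := by
    refine measurable_pi_lambda _ fun i => ?_
    by_cases hi : i ∈ s <;> simp only [e, hi, dite_true, dite_false] <;> fun_prop
  refine ⟨ρ.map e, Measure.isProbabilityMeasure_map he.aemeasurable, ?_, fun t ht => ?_⟩
  · rw [Measure.map_map (Finset.measurable_restrict s) he, ← h2]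
    congr 1
    ext z i
    simp [e]
  · rw [Measure.map_map (Finset.measurable_restrict t) he, ← h1,
      Measure.map_map (Finset.measurable_restrict t) measurable_fst]
    refine Measure.map_congr ?_
    filter_upwards [hae] with z hz
    ext i
    by_cases hi : (i : ι) ∈ s
    · have := congrFun hz ⟨i, ht (Finset.mem_inter.2 ⟨i.2, hi⟩)⟩
      simpa [e, hi] using this.symm
    · simp [e, hi]

/-- Under the running intersection property, probability measures with consistent marginals on
overlaps are the marginals of a single probability measure. -/
theorem RIPFinset.exists_measure_map_restrict_eq {ι : Type*} [DecidableEq ι] {p : ℕ}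
    {I : Fin p → Finset ι} (hI : RIPFinset I) (μ : ∀ k, Measure ((i : I k) → ℝ))
    [∀ k, IsProbabilityMeasure (μ k)]
    (hμ : ∀ j k, (I j ∩ I k).Nonempty →
      (μ j).map (Finset.restrict₂ (π := fun _ => ℝ)
          (Finset.inter_subset_left : I j ∩ I k ⊆ I j)) =
        (μ k).map (Finset.restrict₂ (π := fun _ => ℝ)
          (Finset.inter_subset_right : I j ∩ I k ⊆ I k))) :
    ∃ ν : Measure (ι → ℝ), IsProbabilityMeasure ν ∧ ∀ k, ν.map (I k).restrict = μ k := by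
  suffices H : ∀ q ≤ p, ∃ ν : Measure (ι → ℝ), IsProbabilityMeasure ν ∧
      ∀ k : Fin p, (k : ℕ) < q → ν.map (I k).restrict = μ k by
    obtain ⟨ν, hν, h⟩ := H p le_rfl
    exact ⟨ν, hν, fun k => h k k.2⟩
  intro q
  induction q with
  | zero => exact fun _ => ⟨Measure.dirac 0, inferInstance, fun k hk => absurd hk (by simp)⟩
  | succ q ih =>
    intro hq
    obtain ⟨ν, hν, h⟩ := ih (by omega)
    let k : Fin p := ⟨q, hq⟩
    obtain ⟨T, hT, hmap, hsub⟩ : ∃ (T : Finset ι) (hT : T ⊆ I k),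
        ν.map T.restrict = (μ k).map (Finset.restrict₂ (π := fun _ => ℝ) hT) ∧
        ∀ j : Fin p, (j : ℕ) < q → I j ∩ I k ⊆ T := by
      have hempty : ∀ T : Finset ι, T = ∅ → ∀ hT : T ⊆ I k,
          ν.map T.restrict = (μ k).map (Finset.restrict₂ (π := fun _ => ℝ) hT) := by
        rintro _ rfl hT
        have := Measure.isProbabilityMeasure_map (μ := ν)
          (Finset.measurable_restrict (X := fun _ => ℝ) (∅ : Finset ι)).aemeasurable
        have := Measure.isProbabilityMeasure_map (μ := μ k)
          (Finset.measurable_restrict₂ (X := fun _ => ℝ) hT).aemeasurable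
        ext A -
        rcases A.eq_empty_or_nonempty with rfl | hA
        · simp
        · simp [Subsingleton.eq_univ_of_nonempty hA]
      cases q with
      | zero => exact ⟨∅, by simp, hempty ∅ rfl _, by simp⟩
      | succ r =>
        obtain ⟨l, hl, hsub⟩ := hI r hq
        refine ⟨I l ∩ I k, Finset.inter_subset_right, ?_, fun j hj i hi => ?_⟩
        · rcases (I l ∩ I k).eq_empty_or_nonempty with h0 | hne
          · exact hempty _ h0 _
          · rw [← hμ l k hne, ← h l (by omega),
              Measure.map_map (Finset.measurable_restrict₂ _) (Finset.measurable_restrict _)]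
            rfl
        · obtain ⟨hij, hik⟩ := Finset.mem_inter.1 hi
          refine Finset.mem_inter.2 ⟨hsub (Finset.mem_inter.2 ⟨hik, ?_⟩), hik⟩
          exact Finset.mem_biUnion.2 ⟨j, by simp; omega, hij⟩
    obtain ⟨ν', hν', hk, hold⟩ := exists_measure_extend_marginal hT ν (μ k) hmap
    refine ⟨ν', hν', fun j hj => ?_⟩
    rcases Nat.lt_succ_iff_lt_or_eq.1 hj with hj | hj
    · rw [hold _ (hsub j hj), h j hj]
    · obtain rfl : j = k := Fin.ext hj
      exact hk

theorem map_restrict₂_dirac_restrict {ι : Type*} {s t : Finset ι} (h : t ⊆ s) (x : ι → ℝ) :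
    (Measure.dirac (s.restrict x)).map (Finset.restrict₂ (π := fun _ => ℝ) h) =
      Measure.dirac (t.restrict x) :=
  Measure.map_dirac' (Finset.measurable_restrict₂ h) _

theorem continuous_extZero {n : ℕ} (s : Finset (Fin n)) : Continuous (extZero s) := by
  refine continuous_pi fun i => ?_
  by_cases hi : i ∈ s <;> simp only [extZero, hi, dite_true, dite_false] <;> fun_prop

theorem eval_extZero_restrict {n : ℕ} {s : Finset (Fin n)} {q : MvPolynomial (Fin n) ℝ}
    (hq : q ∈ supported ℝ (s : Set (Fin n))) (x : Fin n → ℝ) :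
    eval (extZero s (s.restrict x)) q = eval x q := by
  refine eval₂Hom_congr' rfl (fun i hi _ => ?_) rfl
  have : i ∈ s := mem_supported.1 hq hi
  simp [extZero, this]

/-- **Correlatively sparse measure reformulation of polynomial optimization**: under the
correlative sparsity assumptions with running intersection property and ball constraints, the
infimum of `Σ_k ∫ f_k dμ_k` over tuples of probability measures `μ_k` supported on `X_k` with
consistent overlapping marginals equals the minimum of `f` on `X`. -/
theorem cs_measure_reformulation_pop (n m p : ℕ)
    (f : MvPolynomial (Fin n) ℝ) (g : Fin m → MvPolynomial (Fin n) ℝ)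
    (K : Set (Fin n → ℝ)) (hK : K = {x | ∀ j, 0 ≤ eval x (g j)}) (hKne : K.Nonempty)
    (I : Fin p → Finset (Fin n)) (hcover : ∀ i : Fin n, ∃ k, i ∈ I k)
    (fk : Fin p → MvPolynomial (Fin n) ℝ)
    (hfsum : f = ∑ k, fk k)
    (hfksupp : ∀ k, fk k ∈ MvPolynomial.supported ℝ ((I k : Finset (Fin n)) : Set (Fin n)))
    (J : Fin p → Finset (Fin m))
    (hJdisj : ∀ k l, k ≠ l → Disjoint (J k) (J l))
    (hJcover : ∀ j : Fin m, ∃ k, j ∈ J k)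
    (hgsupp : ∀ k, ∀ j ∈ J k,
      g j ∈ MvPolynomial.supported ℝ ((I k : Finset (Fin n)) : Set (Fin n)))
    (hRIP : RIPFinset I)
    (hball : ∀ k, ∃ N : ℝ, 0 < N ∧ ∃ j ∈ J k, g j = C N - ∑ i ∈ I k, X i ^ 2) :
    sInf {v : ℝ | ∃ μ : ∀ k : Fin p, Measure ({i // i ∈ I k} → ℝ),
        (∀ k, IsProbabilityMeasure (μ k)) ∧
        (∀ k, μ k ({y : {i // i ∈ I k} → ℝ |
            ∀ j ∈ J k, 0 ≤ eval (extZero (I k) y) (g j)}ᶜ) = 0) ∧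
        (∀ j k : Fin p, (I j ∩ I k).Nonempty →
          Measure.map
              (fun (y : {i // i ∈ I j} → ℝ) (i : {i // i ∈ I j ∩ I k}) =>
                y ⟨i.1, (Finset.mem_inter.mp i.2).1⟩) (μ j) =
            Measure.map
              (fun (y : {i // i ∈ I k} → ℝ) (i : {i // i ∈ I j ∩ I k}) =>
                y ⟨i.1, (Finset.mem_inter.mp i.2).2⟩) (μ k)) ∧
        v = ∑ k, ∫ y, eval (extZero (I k) y) (fk k) ∂(μ k)} =
      sInf {v : ℝ | ∃ x ∈ K, v = eval x f} := by
  have hKmem : ∀ x, x ∈ K ↔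
      ∀ k, ∀ j ∈ J k, 0 ≤ eval (extZero (I k) ((I k).restrict x)) (g j) := by
    intro x
    rw [hK]
    refine ⟨fun h k j hj => ?_, fun h j => ?_⟩
    · rw [eval_extZero_restrict (hgsupp k j hj)]
      exact h j
    · obtain ⟨k, hk⟩ := hJcover j
      rw [← eval_extZero_restrict (hgsupp k j hk)]
      exact h k j hk
  have hKcompact : IsCompact K := by
    choose k hk using hcover
    choose N hN j hj hgj using hball
    refine (isCompact_univ_pi fun i => isCompact_Icc (a := -√(N (k i))) (b := √(N (k i)))
      ).of_isClosed_subset ?_ fun x hx i _ => ?_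
    · rw [hK, Set.ofPred_forall]
      exact isClosed_iInter fun j => isClosed_le continuous_const (MvPolynomial.continuous_eval _)
    · rw [hK] at hx
      have h1 : 0 ≤ eval x (g (j (k i))) := hx _
      simp only [hgj, map_sub, eval_C, map_sum, map_pow, eval_X] at h1
      have h2 : x i ^ 2 ≤ ∑ i ∈ I (k i), x i ^ 2 :=
        Finset.single_le_sum (f := fun i => x i ^ 2) (fun _ _ => sq_nonneg _) (hk i)
      exact abs_le.1 (Real.abs_le_sqrt (by linarith))
  have hbdd : BddBelow {v : ℝ | ∃ x ∈ K, v = eval x f} := by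
    obtain ⟨c, hc⟩ := hKcompact.bddBelow_image (MvPolynomial.continuous_eval f).continuousOn
    exact ⟨c, by rintro _ ⟨x, hx, rfl⟩; exact hc ⟨x, hx, rfl⟩⟩
  refine (fun {A B : Set ℝ} (hB : B.Nonempty) (hBA : B ⊆ A) (hA : ∀ v ∈ A, sInf B ≤ v) =>
    le_antisymm (csInf_le_csInf ⟨_, hA⟩ hB hBA) (le_csInf (hB.mono hBA) hA)) ?_ ?_ ?_
  · obtain ⟨x, hx⟩ := hKne
    exact ⟨_, x, hx, rfl⟩
  · rintro v ⟨x, hx, rfl⟩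
    refine ⟨fun k => Measure.dirac ((I k).restrict x), fun k => inferInstance, fun k => ?_,
      fun j k _ => ?_, ?_⟩
    · refine mem_ae_iff.1 (mem_ae_dirac_iff ?_ |>.2 ((hKmem x).1 hx k))
      simp only [Set.ofPred_forall]
      exact (isClosed_iInter fun j => isClosed_iInter fun _ => isClosed_le continuous_const
        ((MvPolynomial.continuous_eval _).comp (continuous_extZero _))).measurableSet
    · exact (map_restrict₂_dirac_restrict Finset.inter_subset_left x).trans
        (map_restrict₂_dirac_restrict Finset.inter_subset_right x).symm
    · simp only [integral_dirac, eval_extZero_restrict (hfksupp _), hfsum, map_sum]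
  · rintro v ⟨μ, hμ, hsupp, hmarg, rfl⟩
    obtain ⟨ν, hν, hmap⟩ := RIPFinset.exists_measure_map_restrict_eq hRIP μ hmarg
    have hνK : ∀ᵐ x ∂ν, x ∈ K := by
      simp only [hKmem]
      refine ae_all_iff.2 fun k => ?_
      have h : ∀ᵐ y ∂(μ k), ∀ j ∈ J k, 0 ≤ eval (extZero (I k) y) (g j) := hsupp k
      rw [← hmap k] at h
      exact ae_of_ae_map (Finset.measurable_restrict _).aemeasurable h
    have hint : ∀ q : MvPolynomial (Fin n) ℝ, Integrable (fun x => eval x q) ν := by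
      intro q
      have hc := MvPolynomial.continuous_eval q
      obtain ⟨M, hM⟩ := hKcompact.exists_bound_of_continuousOn hc.continuousOn
      exact Integrable.of_bound hc.aestronglyMeasurable M (hνK.mono hM)
    have hval : ∑ k, ∫ y, eval (extZero (I k) y) (fk k) ∂(μ k) = ∫ x, eval x f ∂ν := by
      simp only [hfsum, map_sum]
      rw [integral_finsetSum _ fun k _ => hint _]
      refine Finset.sum_congr rfl fun k _ => ?_
      rw [← hmap k, integral_map (Finset.measurable_restrict _).aemeasurable
        ((MvPolynomial.continuous_eval _).comp (continuous_extZero _)).aestronglyMeasurable]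
      simp only [eval_extZero_restrict (hfksupp k)]
    rw [hval]
    calc sInf {v : ℝ | ∃ x ∈ K, v = eval x f}
        = ∫ _, sInf {v : ℝ | ∃ x ∈ K, v = eval x f} ∂ν := by simp
      _ ≤ ∫ x, eval x f ∂ν := integral_mono_ae (integrable_const _) (hint f)
        (hνK.mono fun x hx => csInf_le hbdd ⟨x, hx, rfl⟩)
end

section
/- Sparse Putinar Positivstellensatz: let f, g₁,…,g_m ∈ ℝ[x₁,…,xₙ] and X = {x ∈ ℝⁿ : g₁(x) ≥ 0, …, g_m(x) ≥ 0}. Assume: (i) there are sets I₁,…,I_p ⊆ {1,…,n} covering {1,…,n} and polynomials f₁,…,f_p with f = f₁ + ⋯ + f_p and f_k ∈ ℝ[x,I_k]; (ii) {1,…,m} is partitioned into J₁,…,J_p with g_j ∈ ℝ[x,I_k] for every j ∈ J_k; (iii) I₁,…,I_p satisfy the running intersection property; (iv) for every k there exist N_k > 0 and j ∈ J_k with g_j = N_k − Σ_{i∈I_k} xᵢ². If f(x) > 0 for all x ∈ X, then f = Σ_{k=1}^p ( σ_{k,0} + Σ_{j∈J_k} σ_{k,j}·g_j ) for some sums of squares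 σ_{k,0}, σ_{k,j} ∈ Σ[x,I_k] (j ∈ J_k, k = 1,…,p). -/
open MvPolynomial

/-- `q` is a sum of squares of polynomials in the variables indexed by `s` (membership in
`Σ[x, s]`). -/
def IsSOSSupported {n : ℕ} (s : Set (Fin n)) (q : MvPolynomial (Fin n) ℝ) : Prop :=
  ∃ (t : ℕ) (h : Fin t → MvPolynomial (Fin n) ℝ),
    (∀ i, h i ∈ MvPolynomial.supported ℝ s) ∧ q = ∑ i, h i ^ 2

/-- A quadratic module of a commutative ring: a set containing `1`, closed under addition and
under multiplication by squares. -/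
structure IsQuadraticModule {A : Type*} [CommRing A] (M : Set A) : Prop where
  one_mem : (1 : A) ∈ M
  add_mem : ∀ {a b : A}, a ∈ M → b ∈ M → a + b ∈ M
  sq_mul_mem : ∀ (b : A) {a : A}, a ∈ M → b * b * a ∈ M

namespace IsQuadraticModule

section Ring

variable {A : Type*} [CommRing A] {M : Set A}

lemma zero_mem (hM : IsQuadraticModule M) : (0 : A) ∈ M := by
  simpa using hM.sq_mul_mem 0 hM.one_mem

lemma mul_self_mem (hM : IsQuadraticModule M) (b : A) : b * b ∈ M := by
  simpa using hM.sq_mul_mem b hM.one_mem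

lemma isSumSq_mul_mem (hM : IsQuadraticModule M) {s a : A} (hs : IsSumSq s) (ha : a ∈ M) :
    s * a ∈ M := by
  induction hs with
  | zero => simpa using hM.zero_mem
  | sq_add b _ ih => rw [add_mul]; exact hM.add_mem (hM.sq_mul_mem b ha) ih

lemma isSumSq_mem (hM : IsQuadraticModule M) {s : A} (hs : IsSumSq s) : s ∈ M := by
  simpa using hM.isSumSq_mul_mem hs hM.one_mem

lemma sum_mem (hM : IsQuadraticModule M) {ι : Type*} {s : Finset ι} {a : ι → A}
    (ha : ∀ i ∈ s, a i ∈ M) : ∑ i ∈ s, a i ∈ M := by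
  classical
  induction s using Finset.induction_on with
  | empty => simpa using hM.zero_mem
  | insert i s hi ih =>
    rw [Finset.sum_insert hi]
    exact hM.add_mem (ha i (by simp)) (ih fun j hj => ha j (by simp [hj]))

/-- The quadratic module generated by a quadratic module and one more element. -/
lemma adjoin (hM : IsQuadraticModule M) (f : A) :
    IsQuadraticModule {a | ∃ q ∈ M, ∃ s, IsSumSq s ∧ a = q + s * f} where
  one_mem := ⟨1, hM.one_mem, 0, .zero, by simp⟩
  add_mem := by
    rintro a b ⟨q, hq, s, hs, rfl⟩ ⟨q', hq', s', hs', rfl⟩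
    exact ⟨q + q', hM.add_mem hq hq', s + s', hs.add hs', by ring⟩
  sq_mul_mem := by
    rintro b a ⟨q, hq, s, hs, rfl⟩
    exact ⟨b * b * q, hM.sq_mul_mem b hq, b * b * s, (IsSumSq.mul_self b).mul hs, by ring⟩

end Ring

variable {A : Type*} [CommRing A] [Algebra ℝ A] {M : Set A}

lemma smul_mem (hM : IsQuadraticModule M) {r : ℝ} (hr : 0 ≤ r) {a : A} (ha : a ∈ M) :
    r • a ∈ M := by
  have h := hM.sq_mul_mem (algebraMap ℝ A (√r)) ha
  rwa [← map_mul, Real.mul_self_sqrt hr, ← Algebra.smul_def] at h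

lemma mem_of_smul_mem (hM : IsQuadraticModule M) {r : ℝ} (hr : 0 < r) {a : A}
    (ha : r • a ∈ M) : a ∈ M := by
  simpa [smul_smul, hr.ne'] using hM.smul_mem (inv_nonneg.2 hr.le) ha

lemma algebraMap_mem (hM : IsQuadraticModule M) {r : ℝ} (hr : 0 ≤ r) :
    algebraMap ℝ A r ∈ M := by
  simpa [Algebra.smul_def] using hM.smul_mem hr hM.one_mem

lemma sub_mul_self_mem (hM : IsQuadraticModule M) {r : ℝ} (hr : 0 < r) {a : A}
    (h₁ : algebraMap ℝ A r - a ∈ M) (h₂ : algebraMap ℝ A r + a ∈ M) :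
    algebraMap ℝ A (r * r) - a * a ∈ M := by
  refine hM.mem_of_smul_mem (r := 2 * r) (by positivity) ?_
  have := hM.add_mem (hM.sq_mul_mem (algebraMap ℝ A r - a) h₂)
    (hM.sq_mul_mem (algebraMap ℝ A r + a) h₁)
  convert this using 1
  simp only [Algebra.smul_def, map_mul, map_ofNat]
  ring

lemma neg_one_mem_of_algebraMap_mem (hM : IsQuadraticModule M) {r : ℝ} (hr : r < 0)
    (h : algebraMap ℝ A r ∈ M) : (-1 : A) ∈ M := by
  refine hM.mem_of_smul_mem (r := -r) (by linarith) ?_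
  simpa [Algebra.smul_def] using h

/-- The set of elements bounded in absolute value by a real number modulo `M` is a subalgebra. -/
def boundedSubalgebra (hM : IsQuadraticModule M) : Subalgebra ℝ A where
  carrier := {a | ∃ N : ℝ, 0 < N ∧ algebraMap ℝ A N - a ∈ M ∧ algebraMap ℝ A N + a ∈ M}
  add_mem' := by
    rintro a b ⟨N, hN, h₁, h₂⟩ ⟨N', hN', h₁', h₂'⟩
    refine ⟨N + N', by positivity, ?_, ?_⟩
    · convert hM.add_mem h₁ h₁' using 1
      rw [map_add]; ring
    · convert hM.add_mem h₂ h₂' using 1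
      rw [map_add]; ring
  mul_mem' := by
    rintro a b ⟨N, hN, h₁, h₂⟩ ⟨N', hN', h₁', h₂'⟩
    have hp := hM.sub_mul_self_mem (r := N + N') (a := a + b) (by positivity)
      (by convert hM.add_mem h₁ h₁' using 1; rw [map_add]; ring)
      (by convert hM.add_mem h₂ h₂' using 1; rw [map_add]; ring)
    have hm := hM.sub_mul_self_mem (r := N + N') (a := a - b) (by positivity)
      (by convert hM.add_mem h₁ h₂' using 1; rw [map_add]; ring)
      (by convert hM.add_mem h₂ h₁' using 1; rw [map_add]; ring)
    refine ⟨(N + N') * (N + N'), by positivity, ?_, ?_⟩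
    · refine hM.mem_of_smul_mem (r := 4) (by norm_num) ?_
      convert hM.add_mem (hM.add_mem hp (hM.mul_self_mem (a - b)))
        (hM.algebraMap_mem (r := 3 * ((N + N') * (N + N'))) (by positivity)) using 1
      simp only [Algebra.smul_def, map_mul, map_add, map_ofNat]
      ring
    · refine hM.mem_of_smul_mem (r := 4) (by norm_num) ?_
      convert hM.add_mem (hM.add_mem hm (hM.mul_self_mem (a + b)))
        (hM.algebraMap_mem (r := 3 * ((N + N') * (N + N'))) (by positivity)) using 1
      simp only [Algebra.smul_def, map_mul, map_add, map_ofNat]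
      ring
  algebraMap_mem' := by
    intro r
    refine ⟨|r| + 1, by positivity, ?_, ?_⟩
    · rw [← map_sub]
      exact hM.algebraMap_mem (by linarith [le_abs_self r])
    · rw [← map_add]
      exact hM.algebraMap_mem (by linarith [neg_abs_le r])

lemma mem_boundedSubalgebra_of_sub_mul_self_mem (hM : IsQuadraticModule M) {N : ℝ} {a : A}
    (h : algebraMap ℝ A N - a * a ∈ M) : a ∈ hM.boundedSubalgebra := by
  have key : ∀ b : A, b * b = a * a → algebraMap ℝ A (|N| + 1) - b ∈ M := by
    intro b hb
    have h' := hM.add_mem (hM.add_mem (hb ▸ h) (hM.mul_self_mem (b - algebraMap ℝ A (1 / 2))))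
      (hM.algebraMap_mem (r := |N| + 1 - (N + 1 / 4)) (by linarith [le_abs_self N]))
    convert h' using 1
    have h2 : (2 : A) * algebraMap ℝ A (1 / 2) = 1 := by
      rw [← map_ofNat (algebraMap ℝ A) 2, ← map_mul]; norm_num
    have h4 : algebraMap ℝ A (1 / 4) = algebraMap ℝ A (1 / 2) * algebraMap ℝ A (1 / 2) := by
      rw [← map_mul]; norm_num
    simp only [map_add, map_sub, map_one, h4]
    linear_combination b * h2
  refine ⟨|N| + 1, by positivity, key a rfl, ?_⟩
  simpa using key (-a) (by ring)

/-- A quadratic module is Archimedean if every element is bounded above by a real number. -/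
def IsArchimedean (M : Set A) : Prop := ∀ a : A, ∃ N : ℝ, algebraMap ℝ A N - a ∈ M

/-- `a` is infinitesimally close to the real number `c` modulo `M`. -/
def IsStandardPart (M : Set A) (a : A) (c : ℝ) : Prop :=
  ∀ ε : ℝ, 0 < ε → algebraMap ℝ A ε + (a - algebraMap ℝ A c) ∈ M ∧
    algebraMap ℝ A ε - (a - algebraMap ℝ A c) ∈ M

lemma isStandardPart_add (hM : IsQuadraticModule M) {a b : A} {c d : ℝ}
    (ha : IsStandardPart M a c) (hb : IsStandardPart M b d) :
    IsStandardPart M (a + b) (c + d) := by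
  intro ε hε
  have e : algebraMap ℝ A ε = algebraMap ℝ A (ε / 2) + algebraMap ℝ A (ε / 2) := by
    rw [← map_add, add_halves]
  constructor
  · convert hM.add_mem (ha (ε / 2) (by positivity)).1 (hb (ε / 2) (by positivity)).1 using 1
    rw [map_add, e]; ring
  · convert hM.add_mem (ha (ε / 2) (by positivity)).2 (hb (ε / 2) (by positivity)).2 using 1
    rw [map_add, e]; ring

lemma isStandardPart_algebraMap (hM : IsQuadraticModule M) (r : ℝ) :
    IsStandardPart M (algebraMap ℝ A r) r := by
  intro ε hε
  simpa using hM.algebraMap_mem hε.le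

lemma isStandardPart_neg {a : A} {c : ℝ} (ha : IsStandardPart M a c) :
    IsStandardPart M (-a) (-c) := by
  intro ε hε
  obtain ⟨h₁, h₂⟩ := ha ε hε
  constructor
  · convert h₂ using 1
    rw [map_neg]; ring
  · convert h₁ using 1
    rw [map_neg]; ring

lemma isStandardPart_smul (hM : IsQuadraticModule M) {a : A} {c : ℝ}
    (ha : IsStandardPart M a c) (r : ℝ) : IsStandardPart M (r • a) (r * c) := by
  have pos : ∀ r : ℝ, 0 < r → IsStandardPart M (r • a) (r * c) := by
    intro r hr ε hε
    obtain ⟨h₁, h₂⟩ := ha (ε / r) (by positivity)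
    have e : algebraMap ℝ A ε = algebraMap ℝ A r * algebraMap ℝ A (ε / r) := by
      rw [← map_mul, mul_div_cancel₀ _ hr.ne']
    constructor
    · convert hM.smul_mem hr.le h₁ using 1
      simp only [Algebra.smul_def, map_mul, e]; ring
    · convert hM.smul_mem hr.le h₂ using 1
      simp only [Algebra.smul_def, map_mul, e]; ring
  rcases lt_trichotomy r 0 with hr | rfl | hr
  · simpa using isStandardPart_neg (pos (-r) (by linarith))
  · simpa using hM.isStandardPart_algebraMap 0
  · exact pos r hr

lemma isStandardPart_mul_self (hM : IsQuadraticModule M) {a : A} {c : ℝ}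
    (ha : IsStandardPart M a c) : IsStandardPart M (a * a) (c * c) := by
  have h0 : IsStandardPart M ((a - algebraMap ℝ A c) * (a - algebraMap ℝ A c)) 0 := by
    intro ε hε
    obtain ⟨h₁, h₂⟩ := ha (√ε) (Real.sqrt_pos.2 hε)
    simp only [map_zero, sub_zero]
    refine ⟨hM.add_mem (hM.algebraMap_mem hε.le) (hM.mul_self_mem _), ?_⟩
    have := hM.sub_mul_self_mem (Real.sqrt_pos.2 hε) h₂ h₁
    rwa [Real.mul_self_sqrt hε.le] at this
  convert hM.isStandardPart_add (hM.isStandardPart_add h0 (hM.isStandardPart_smul ha (2 * c)))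
    (hM.isStandardPart_algebraMap (-(c * c))) using 1
  · simp only [Algebra.smul_def, map_mul, map_neg, map_ofNat]; ring
  · ring

lemma isStandardPart_unique (hM : IsQuadraticModule M) (h1 : (-1 : A) ∉ M) {a : A} {c d : ℝ}
    (hc : IsStandardPart M a c) (hd : IsStandardPart M a d) : c = d := by
  have key : ∀ {c d : ℝ}, IsStandardPart M a c → IsStandardPart M a d → c ≤ d := by
    intro c d hc hd
    by_contra! hlt
    refine h1 (hM.neg_one_mem_of_algebraMap_mem (r := (d - c) / 2) (by linarith) ?_)
    convert hM.add_mem (hc ((c - d) / 4) (by linarith)).1 (hd ((c - d) / 4) (by linarith)).2 using 1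
    have e : (d - c) / 2 = (c - d) / 4 + (c - d) / 4 - c + d := by ring
    rw [e]
    simp only [map_add, map_sub]
    ring
  exact le_antisymm (key hc hd) (key hd hc)

lemma exists_isStandardPart (hM : IsQuadraticModule M) (h1 : (-1 : A) ∉ M)
    (harch : IsArchimedean M) (htot : ∀ a : A, a ∈ M ∨ -a ∈ M) (a : A) :
    ∃ c, IsStandardPart M a c := by
  let S : Set ℝ := {r | a - algebraMap ℝ A r ∈ M}
  have hne : S.Nonempty := by
    obtain ⟨N, hN⟩ := harch (-a)
    refine ⟨-N, ?_⟩
    change a - algebraMap ℝ A (-N) ∈ M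
    convert hN using 1
    rw [map_neg]; ring
  have hbdd : BddAbove S := by
    obtain ⟨N, hN⟩ := harch a
    refine ⟨N, fun r hr => ?_⟩
    by_contra! hlt
    refine h1 (hM.neg_one_mem_of_algebraMap_mem (r := N - r) (by linarith) ?_)
    convert hM.add_mem hr hN using 1
    rw [map_sub]; ring
  refine ⟨sSup S, fun ε hε => ⟨?_, ?_⟩⟩
  · obtain ⟨r, hr, hlt⟩ := exists_lt_of_lt_csSup hne (show sSup S - ε < sSup S by linarith)
    convert hM.add_mem hr (hM.algebraMap_mem (r := r - (sSup S - ε)) (by linarith)) using 1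
    simp only [map_sub]; ring
  · have hn : sSup S + ε ∉ S := fun h => by linarith [le_csSup hbdd h]
    convert (htot (a - algebraMap ℝ A (sSup S + ε))).resolve_left hn using 1
    rw [map_add]; ring

/-- A total proper Archimedean quadratic module is nonnegative at some real character. -/
lemma exists_algHom_of_total (hM : IsQuadraticModule M) (h1 : (-1 : A) ∉ M)
    (harch : IsArchimedean M) (htot : ∀ a : A, a ∈ M ∨ -a ∈ M) :
    ∃ φ : A →ₐ[ℝ] ℝ, ∀ a ∈ M, 0 ≤ φ a := by
  choose φ hφ using hM.exists_isStandardPart h1 harch htot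
  have eq : ∀ {a c}, IsStandardPart M a c → φ a = c :=
    fun h => hM.isStandardPart_unique h1 (hφ _) h
  have hC : ∀ r : ℝ, φ (algebraMap ℝ A r) = r := fun r => eq (hM.isStandardPart_algebraMap r)
  have hadd : ∀ a b, φ (a + b) = φ a + φ b := fun a b => eq (hM.isStandardPart_add (hφ a) (hφ b))
  have hsq : ∀ a, φ (a * a) = φ a * φ a := fun a => eq (hM.isStandardPart_mul_self (hφ a))
  have hmul : ∀ a b, φ (a * b) = φ a * φ b := by
    intro a b
    have h := hsq (a + b)
    rw [show (a + b) * (a + b) = a * a + (a * b + a * b) + b * b by ring] at h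
    simp only [hadd, hsq] at h
    linarith
  refine ⟨{ toFun := φ
            map_one' := by simpa using hC 1
            map_mul' := hmul
            map_zero' := by simpa using hC 0
            map_add' := hadd
            commutes' := hC }, fun a ha => ?_⟩
  change 0 ≤ φ a
  by_contra! hlt
  refine h1 (hM.neg_one_mem_of_algebraMap_mem (r := φ a / 2) (by linarith) ?_)
  convert hM.add_mem ha (hφ a (-(φ a) / 2) (by linarith)).2 using 1
  rw [show φ a / 2 = -φ a / 2 + φ a by ring, map_add]
  ring

lemma total_of_maximal (hM : Maximal (fun Q : Set A => IsQuadraticModule Q ∧ (-1 : A) ∉ Q) M)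
    (a : A) : a ∈ M ∨ -a ∈ M := by
  obtain ⟨hQ, h1⟩ := hM.prop
  have key : ∀ b : A, b ∉ M → ∃ q ∈ M, ∃ s, IsSumSq s ∧ -1 = q + s * b := by
    intro b hb
    by_contra hcon
    refine hb (hM.le_of_ge ⟨hQ.adjoin b, hcon⟩ (fun q hq => ⟨q, hq, 0, .zero, by simp⟩)
      ⟨0, hQ.zero_mem, 1, .one, by simp⟩)
  by_contra! hcon
  obtain ⟨q, hq, s, hs, e⟩ := key a hcon.1
  obtain ⟨q', hq', s', hs', e'⟩ := key (-a) hcon.2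
  have hneg : -s ∈ M := by
    convert hQ.add_mem (hQ.add_mem (hQ.isSumSq_mul_mem hs' hq) (hQ.isSumSq_mul_mem hs hq'))
      (hQ.isSumSq_mem hs') using 1
    linear_combination s' * e + s * e'
  have hsa : s * a ∈ M := by
    refine hQ.mem_of_smul_mem (r := 4) (by norm_num) ?_
    convert hQ.add_mem (hQ.isSumSq_mul_mem hs (hQ.mul_self_mem (a + 1)))
      (hQ.sq_mul_mem (a - 1) hneg) using 1
    simp only [Algebra.smul_def, map_ofNat]
    ring
  exact h1 (e ▸ hQ.add_mem hq hsa)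

lemma exists_algHom_of_neg_one_notMem (hM : IsQuadraticModule M) (h1 : (-1 : A) ∉ M)
    (harch : IsArchimedean M) : ∃ φ : A →ₐ[ℝ] ℝ, ∀ a ∈ M, 0 ≤ φ a := by
  obtain ⟨Q, hMQ, hQ⟩ := zorn_subset_nonempty
    {Q : Set A | IsQuadraticModule Q ∧ (-1 : A) ∉ Q} (by
      intro c hc hchain hne
      refine ⟨⋃₀ c, ⟨⟨?_, ?_, ?_⟩, ?_⟩, fun s hs => Set.subset_sUnion_of_mem hs⟩
      · obtain ⟨s, hs⟩ := hne
        exact ⟨s, hs, (hc hs).1.one_mem⟩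
      · rintro a b ⟨s, hs, ha⟩ ⟨t, ht, hb⟩
        rcases hchain.total hs ht with h | h
        · exact ⟨t, ht, (hc ht).1.add_mem (h ha) hb⟩
        · exact ⟨s, hs, (hc hs).1.add_mem ha (h hb)⟩
      · rintro b a ⟨s, hs, ha⟩
        exact ⟨s, hs, (hc hs).1.sq_mul_mem b ha⟩
      · rintro ⟨s, hs, ha⟩
        exact (hc hs).2 ha) M ⟨hM, h1⟩
  obtain ⟨φ, hφ⟩ := hQ.prop.1.exists_algHom_of_total hQ.prop.2
    (fun a => (harch a).imp fun N hN => hMQ hN) (total_of_maximal hQ)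
  exact ⟨φ, fun a ha => hφ a (hMQ ha)⟩

/-- **Jacobi–Putinar representation theorem**: an element that is positive at all real characters
nonnegative on an Archimedean quadratic module belongs to the quadratic module. -/
theorem mem_of_forall_algHom_pos (hM : IsQuadraticModule M) (harch : IsArchimedean M) {f : A}
    (hf : ∀ φ : A →ₐ[ℝ] ℝ, (∀ a ∈ M, 0 ≤ φ a) → 0 < φ f) : f ∈ M := by
  have hex : ∃ s, IsSumSq s ∧ s * f - 1 ∈ M := by
    by_contra! hcon
    obtain ⟨φ, hφ⟩ := (hM.adjoin (-f)).exists_algHom_of_neg_one_notMem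
      (by
        rintro ⟨q, hq, s, hs, e⟩
        refine hcon s hs ?_
        convert hq using 1
        linear_combination e)
      (fun a => (harch a).imp fun N hN => ⟨_, hN, 0, .zero, by simp⟩)
    have h₁ := hf φ fun a ha => hφ a ⟨a, ha, 0, .zero, by simp⟩
    have h₂ := hφ (-f) ⟨0, hM.zero_mem, 1, .one, by simp⟩
    rw [map_neg] at h₂
    linarith
  obtain ⟨s, hs, hsf⟩ := hex
  obtain ⟨N₁, hN₁⟩ := harch s
  obtain ⟨N₂, hN₂⟩ := harch (s * s * f)
  obtain ⟨r₀, hr₀⟩ := harch (-f)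
  obtain ⟨k, hk, hk₁, hk₂⟩ : ∃ k : ℝ, 0 < k ∧ N₁ ≤ 2 * k ∧ N₂ ≤ 2 * k - 1 :=
    ⟨|N₁| + |N₂| + 1, by positivity,
      by linarith [le_abs_self N₁, abs_nonneg N₁, abs_nonneg N₂],
      by linarith [le_abs_self N₂, abs_nonneg N₁, abs_nonneg N₂]⟩
  have hks : algebraMap ℝ A (2 * k) - s ∈ M := by
    convert hM.add_mem hN₁ (hM.algebraMap_mem (r := 2 * k - N₁) (by linarith)) using 1
    rw [map_sub]; ring
  have hksf : algebraMap ℝ A (2 * k - 1) - s * s * f ∈ M := by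
    convert hM.add_mem hN₂ (hM.algebraMap_mem (r := 2 * k - 1 - N₂) (by linarith)) using 1
    rw [map_sub _ (2 * k - 1)]; ring
  have hsk : s * (algebraMap ℝ A (2 * k) - s) ∈ M := hM.isSumSq_mul_mem hs hks
  have step : ∀ r : ℝ, 0 ≤ r → f + algebraMap ℝ A r ∈ M →
      f + algebraMap ℝ A (r - 1 / (k * k)) ∈ M := by
    intro r hr h
    refine hM.mem_of_smul_mem (r := k * k) (by positivity) ?_
    convert hM.add_mem (hM.add_mem (hM.add_mem (hM.sq_mul_mem (algebraMap ℝ A k - s) h)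
      (hM.smul_mem (r := 2 * k) (by positivity) hsf)) hksf) (hM.smul_mem hr hsk) using 1
    have e : algebraMap ℝ A k * algebraMap ℝ A k * algebraMap ℝ A (1 / (k * k)) = 1 := by
      rw [← map_mul, ← map_mul, mul_one_div_cancel (by positivity), map_one]
    simp only [Algebra.smul_def, map_mul, map_sub, map_ofNat, map_one] at e ⊢
    linear_combination -e
  have hall : ∀ j : ℕ, f + algebraMap ℝ A (max (r₀ - j * (1 / (k * k))) 0) ∈ M := by
    intro j
    induction j with
    | zero =>
      convert hM.add_mem hr₀ (hM.algebraMap_mem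
        (r := max (r₀ - ((0 : ℕ) : ℝ) * (1 / (k * k))) 0 - r₀) ?_) using 1
      · rw [map_sub]; ring
      · have := le_max_left (r₀ - ((0 : ℕ) : ℝ) * (1 / (k * k))) 0
        simp only [Nat.cast_zero, zero_mul, sub_zero] at this ⊢
        linarith
    | succ j ih =>
      set r := max (r₀ - j * (1 / (k * k))) 0 with hr
      have hle : r - 1 / (k * k) ≤ max (r₀ - ((j + 1 : ℕ) : ℝ) * (1 / (k * k))) 0 := by
        have hpos : 0 < 1 / (k * k) := by positivity
        rcases max_cases (r₀ - j * (1 / (k * k))) 0 with ⟨h, -⟩ | ⟨h, -⟩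
        · refine le_trans (le_of_eq ?_) (le_max_left _ _)
          rw [hr, h]; push_cast; ring
        · refine le_trans ?_ (le_max_right _ _)
          rw [hr, h]; linarith
      convert hM.add_mem (step r (le_max_right _ _) ih)
        (hM.algebraMap_mem (sub_nonneg.2 hle)) using 1
      simp only [map_sub]; ring
  obtain ⟨j, hj⟩ := exists_nat_gt (r₀ * (k * k))
  have hz : max (r₀ - j * (1 / (k * k))) 0 = 0 := by
    refine max_eq_right ?_
    rw [mul_one_div, sub_nonpos, le_div_iff₀ (by positivity)]
    exact hj.le
  have h := hall j
  rwa [hz, map_zero, add_zero] at h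

end IsQuadraticModule

section Separation

open Set Topology

/-- Two functions on compact sets that are strictly ordered on fibres of a continuous map are
separated by a continuous function on the base. -/
lemma exists_continuousMap_separating {P B : Type*} [TopologicalSpace P] [MetricSpace B]
    {Y Z : Set P} (hY : IsCompact Y) (hZ : IsCompact Z) {π : P → B} (hπ : Continuous π)
    {a b : P → ℝ} (ha : Continuous a) (hb : Continuous b)
    (hab : ∀ y ∈ Y, ∀ z ∈ Z, π y = π z → a y < b z) :
    ∃ h : C(B, ℝ), (∀ y ∈ Y, a y < h (π y)) ∧ ∀ z ∈ Z, h (π z) < b z := by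
  let t : B → Set ℝ := fun s => {c | (∀ y ∈ Y, π y = s → a y < c) ∧ ∀ z ∈ Z, π z = s → c < b z}
  have ht : ∀ s, Convex ℝ (t s) := fun s =>
    (ordConnected_def.2 fun c hc e he d hd =>
      ⟨fun y hy hs => (hc.1 y hy hs).trans_le hd.1,
        fun z hz hs => hd.2.trans_lt (he.2 z hz hs)⟩ : OrdConnected (t s)).convex
  have hne : ∀ s, (t s).Nonempty := by
    intro s
    have hYs : IsCompact (Y ∩ π ⁻¹' {s}) := hY.inter_right (isClosed_singleton.preimage hπ)
    have hZs : IsCompact (Z ∩ π ⁻¹' {s}) := hZ.inter_right (isClosed_singleton.preimage hπ)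
    rcases (Y ∩ π ⁻¹' {s}).eq_empty_or_nonempty with hYe | hYn
    · have hy : ∀ y ∈ Y, π y ≠ s := fun y hy hs => by
        have : y ∈ Y ∩ π ⁻¹' {s} := ⟨hy, hs⟩
        simp [hYe] at this
      rcases (Z ∩ π ⁻¹' {s}).eq_empty_or_nonempty with hZe | hZn
      · refine ⟨0, fun y h hs => (hy y h hs).elim, fun z h hs => ?_⟩
        have : z ∈ Z ∩ π ⁻¹' {s} := ⟨h, hs⟩
        simp [hZe] at this
      · obtain ⟨z₀, -, hmin⟩ := hZs.exists_isMinOn hZn hb.continuousOn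
        refine ⟨b z₀ - 1, fun y h hs => (hy y h hs).elim, fun z h hs => ?_⟩
        have : b z₀ ≤ b z := hmin ⟨h, hs⟩
        linarith
    · obtain ⟨y₀, hy₀, hmax⟩ := hYs.exists_isMaxOn hYn ha.continuousOn
      have hmax' : ∀ y ∈ Y, π y = s → a y ≤ a y₀ := fun y h hs => hmax ⟨h, hs⟩
      rcases (Z ∩ π ⁻¹' {s}).eq_empty_or_nonempty with hZe | hZn
      · refine ⟨a y₀ + 1, fun y h hs => by linarith [hmax' y h hs], fun z h hs => ?_⟩
        have : z ∈ Z ∩ π ⁻¹' {s} := ⟨h, hs⟩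
        simp [hZe] at this
      · obtain ⟨z₀, hz₀, hmin⟩ := hZs.exists_isMinOn hZn hb.continuousOn
        have hlt := hab y₀ hy₀.1 z₀ hz₀.1 (hy₀.2.trans hz₀.2.symm)
        refine ⟨(a y₀ + b z₀) / 2, fun y h hs => by linarith [hmax' y h hs], fun z h hs => ?_⟩
        have : b z₀ ≤ b z := hmin ⟨h, hs⟩
        linarith
  obtain ⟨h, hh⟩ := exists_continuous_forall_mem_convex_of_local_const ht (fun s => by
    obtain ⟨c, hc₁, hc₂⟩ := hne s
    refine ⟨c, ?_⟩
    have h₁ : (π '' (Y ∩ {y | c ≤ a y}))ᶜ ∈ 𝓝 s :=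
      ((hY.inter_right (isClosed_le continuous_const ha)).image hπ).isClosed.isOpen_compl.mem_nhds
        (by rintro ⟨y, ⟨hy, hle⟩, rfl⟩; exact (hc₁ y hy rfl).not_ge hle)
    have h₂ : (π '' (Z ∩ {z | b z ≤ c}))ᶜ ∈ 𝓝 s :=
      ((hZ.inter_right (isClosed_le hb continuous_const)).image hπ).isClosed.isOpen_compl.mem_nhds
        (by rintro ⟨z, ⟨hz, hle⟩, rfl⟩; exact (hc₂ z hz rfl).not_ge hle)
    filter_upwards [h₁, h₂] with s' h₁ h₂
    refine ⟨fun y hy hs => ?_, fun z hz hs => ?_⟩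
    · by_contra! hle
      exact h₁ ⟨y, ⟨hy, hle⟩, hs⟩
    · by_contra! hle
      exact h₂ ⟨z, ⟨hz, hle⟩, hs⟩)
  exact ⟨h, fun y hy => (hh (π y)).1 y hy rfl, fun z hz => (hh (π z)).2 z hz rfl⟩

/-- Stone–Weierstrass for polynomials in finitely or infinitely many variables. -/
lemma exists_mvPolynomial_near {τ : Type*} (h : C(τ → ℝ, ℝ)) {K : Set (τ → ℝ)}
    (hK : IsCompact K) {ε : ℝ} (hε : 0 < ε) :
    ∃ q : MvPolynomial τ ℝ, ∀ x ∈ K, |eval x q - h x| < ε := by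
  let Φ : MvPolynomial τ ℝ →ₐ[ℝ] C(τ → ℝ, ℝ) :=
    aeval fun i => ⟨fun x => x i, continuous_apply i⟩
  have hΦ : ∀ q x, Φ q x = eval x q := by
    intro q x
    induction q using MvPolynomial.induction_on with
    | C r => simp [Φ]
    | add p q hp hq => simp [hp, hq]
    | mul_X p i hp => simp [hp]; simp [Φ]
  have hsep : Φ.range.SeparatesPoints := by
    intro x y hxy
    obtain ⟨i, hi⟩ := Function.ne_iff.1 hxy
    refine ⟨Φ (X i), ⟨Φ (X i), ⟨X i, rfl⟩, rfl⟩, ?_⟩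
    simpa [hΦ] using hi
  obtain ⟨-, ⟨q, rfl⟩, hq⟩ :=
    ContinuousMap.exists_mem_subalgebra_near_continuous_of_isCompact_of_separatesPoints
      hsep h hK hε
  refine ⟨q, fun x hx => ?_⟩
  have := hq x hx
  rw [Real.norm_eq_abs] at this
  exact (hΦ q x) ▸ this

lemma exists_pos_le_of_isCompact {P : Type*} [TopologicalSpace P] {Y : Set P} (hY : IsCompact Y)
    {u : P → ℝ} (hu : Continuous u) (hpos : ∀ y ∈ Y, 0 < u y) : ∃ ε > 0, ∀ y ∈ Y, ε ≤ u y := by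
  rcases Y.eq_empty_or_nonempty with rfl | hne
  · exact ⟨1, one_pos, by simp⟩
  · obtain ⟨y₀, hy₀, hmin⟩ := hY.exists_isMinOn hne hu.continuousOn
    exact ⟨u y₀, hpos y₀ hy₀, fun y hy => hmin hy⟩

lemma exists_supported_separating {ι : Type*} [Finite ι] (S : Set ι) {Y Z : Set (ι → ℝ)}
    (hY : IsCompact Y) (hZ : IsCompact Z) {a b : (ι → ℝ) → ℝ} (ha : Continuous a)
    (hb : Continuous b)
    (hab : ∀ y ∈ Y, ∀ z ∈ Z, (∀ i ∈ S, y i = z i) → a y < b z) :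
    ∃ q ∈ supported ℝ S, (∀ y ∈ Y, a y < eval y q) ∧ ∀ z ∈ Z, eval z q < b z := by
  have := Fintype.ofFinite S
  let π : (ι → ℝ) → (S → ℝ) := fun x i => x i
  have hπ : Continuous π := by fun_prop
  obtain ⟨h, h₁, h₂⟩ := exists_continuousMap_separating hY hZ hπ ha hb
    fun y hy z hz e => hab y hy z hz fun i hi => congrFun e ⟨i, hi⟩
  have hhπ : Continuous fun x => h (π x) := h.continuous.comp hπ
  obtain ⟨ε₁, hε₁, hl⟩ := exists_pos_le_of_isCompact hY (hhπ.sub ha)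
    fun y hy => sub_pos.2 (h₁ y hy)
  obtain ⟨ε₂, hε₂, hr⟩ := exists_pos_le_of_isCompact hZ (hb.sub hhπ)
    fun z hz => sub_pos.2 (h₂ z hz)
  obtain ⟨q, hq⟩ := exists_mvPolynomial_near h ((hY.image hπ).union (hZ.image hπ))
    (lt_min hε₁ hε₂)
  have heval : ∀ x, eval x (rename ((↑) : S → ι) q) = eval (π x) q := fun x => eval_rename _ _ _
  refine ⟨rename (↑) q, ?_, fun y hy => ?_, fun z hz => ?_⟩
  · rw [supported_eq_range_rename]
    exact ⟨q, rfl⟩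
  · have := (abs_lt.1 (hq _ (.inl ⟨y, hy, rfl⟩))).1
    have : ε₁ ≤ h (π y) - a y := hl y hy
    have := min_le_left ε₁ ε₂
    rw [heval]
    linarith
  · have := (abs_lt.1 (hq _ (.inr ⟨z, hz, rfl⟩))).2
    have : ε₂ ≤ b z - h (π z) := hr z hz
    have := min_le_right ε₁ ε₂
    rw [heval]
    linarith

end Separation

lemma eval_congr_of_mem_supported {ι : Type*} {s : Set ι} {q : MvPolynomial ι ℝ}
    (hq : q ∈ supported ℝ s) {x y : ι → ℝ} (h : ∀ i ∈ s, x i = y i) : eval x q = eval y q :=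
  eval₂Hom_congr' rfl (fun _ hi _ => h _ (mem_supported.1 hq hi)) rfl

lemma isCompact_of_isClosed_of_abs_le {ι : Type*} {Y : Set (ι → ℝ)} (hY : IsClosed Y) {R : ℝ}
    (hR : ∀ y ∈ Y, ∀ i, |y i| ≤ R) : IsCompact Y :=
  (isCompact_univ_pi fun _ => isCompact_Icc (a := -R) (b := R)).of_isClosed_subset hY
    fun y hy i _ => abs_le.1 (hR y hy i)

/-- Under the running intersection property, a sum of polynomials in the variables `I k` that is
positive on an intersection of compact cylinders `K k` over the variables `I k` can be rearranged
so that each summand is positive on its own cylinder. -/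
lemma exists_sum_eq_of_sum_pos {ι : Type*} [Finite ι] [DecidableEq ι] (I : ℕ → Finset ι)
    (K : ℕ → Set (ι → ℝ)) (hclosed : ∀ k, IsClosed (K k))
    (hcyl : ∀ k x y, (∀ i ∈ I k, x i = y i) → x ∈ K k → y ∈ K k)
    (hbdd : ∀ k, ∃ R : ℝ, ∀ x ∈ K k, ∀ i ∈ I k, |x i| ≤ R) (q : ℕ)
    (hRIP : ∀ k < q, ∃ l ≤ k, ∀ i ∈ I (k + 1), ∀ j ≤ k, i ∈ I j → i ∈ I l)
    (f : ℕ → MvPolynomial ι ℝ) (hf : ∀ k ≤ q, f k ∈ supported ℝ (I k : Set ι))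
    (hpos : ∀ x, (∀ k ≤ q, x ∈ K k) → 0 < eval x (∑ k ∈ Finset.range (q + 1), f k)) :
    ∃ h : ℕ → MvPolynomial ι ℝ, (∀ k ≤ q, h k ∈ supported ℝ (I k : Set ι)) ∧
      (∀ k ≤ q, ∀ x ∈ K k, 0 < eval x (h k)) ∧
      ∑ k ∈ Finset.range (q + 1), h k = ∑ k ∈ Finset.range (q + 1), f k := by
  induction q generalizing f with
  | zero =>
    refine ⟨f, hf, ?_, rfl⟩
    intro k hk x hx
    obtain rfl : k = 0 := by omega
    simpa using hpos x fun k hk => Nat.le_zero.1 hk ▸ hx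
  | succ q ih =>
    obtain ⟨l, hlq, hl⟩ := hRIP q (by omega)
    choose R hR using hbdd
    set F := ∑ k ∈ Finset.range (q + 1), f k with hF
    have hFcongr : ∀ x y : ι → ℝ, (∀ k ≤ q, ∀ i ∈ I k, x i = y i) → eval x F = eval y F := by
      intro x y hxy
      simp only [hF, map_sum]
      refine Finset.sum_congr rfl fun k hk => ?_
      have hk' : k ≤ q := by simpa [Nat.lt_succ_iff] using hk
      exact eval_congr_of_mem_supported (hf k (by omega)) (hxy k hk')
    let Y : Set (ι → ℝ) := {y | (∀ k ≤ q, y ∈ K k) ∧ ∀ i, (∀ k ≤ q, i ∉ I k) → y i = 0}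
    let Z : Set (ι → ℝ) := {z | z ∈ K (q + 1) ∧ ∀ i, i ∉ I (q + 1) → z i = 0}
    have hY : IsCompact Y := by
      refine isCompact_of_isClosed_of_abs_le (R := ∑ k ∈ Finset.range (q + 1), |R k|) ?_ ?_
      · simp only [Y, Set.ofPred_and, Set.ofPred_forall]
        exact (isClosed_biInter fun k _ => hclosed k).inter
          (isClosed_iInter fun i => isClosed_iInter fun _ =>
            isClosed_eq (continuous_apply i) continuous_const)
      · intro y hy i
        by_cases hi : ∀ k ≤ q, i ∉ I k
        · rw [hy.2 i hi, abs_zero]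
          exact Finset.sum_nonneg fun _ _ => abs_nonneg _
        · push Not at hi
          obtain ⟨k, hk, hik⟩ := hi
          refine ((hR k y (hy.1 k hk) i hik).trans (le_abs_self _)).trans ?_
          exact Finset.single_le_sum (f := fun k => |R k|) (fun _ _ => abs_nonneg _)
            (by simp only [Finset.mem_range]; omega)
    have hZ : IsCompact Z := by
      refine isCompact_of_isClosed_of_abs_le (R := |R (q + 1)|) ?_ ?_
      · simp only [Z, Set.ofPred_and, Set.ofPred_forall]
        exact (hclosed _).inter (isClosed_iInter fun i => isClosed_iInter fun _ =>
            isClosed_eq (continuous_apply i) continuous_const)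
      · intro z hz i
        by_cases hi : i ∈ I (q + 1)
        · exact (hR _ z hz.1 i hi).trans (le_abs_self _)
        · rw [hz.2 i hi, abs_zero]
          exact abs_nonneg _
    obtain ⟨p, hp, hpY, hpZ⟩ := exists_supported_separating
      {i | i ∈ I (q + 1) ∧ ∃ j ≤ q, i ∈ I j} hY hZ
      (a := fun y => -eval y F) (b := fun z => eval z (f (q + 1)))
      (continuous_eval F).neg (continuous_eval _) (by
        intro y hy z hz hyz
        let x : ι → ℝ := fun i => if i ∈ I (q + 1) then z i else y i
        have hxz : ∀ i ∈ I (q + 1), z i = x i := fun i hi => by simp [x, hi]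
        have hxy : ∀ k ≤ q, ∀ i ∈ I k, y i = x i := fun k hk i hi => by
          by_cases h : i ∈ I (q + 1)
          · simpa [x, h] using hyz i ⟨h, k, hk, hi⟩
          · simp [x, h]
        have := hpos x (fun k hk => by
          rcases Nat.lt_or_ge q k with h | h
          · obtain rfl : k = q + 1 := by omega
            exact hcyl _ _ _ hxz hz.1
          · exact hcyl _ _ _ (hxy k h) (hy.1 k h))
        rw [Finset.sum_range_succ, map_add, ← hF, ← hFcongr y x hxy,
          ← eval_congr_of_mem_supported (hf (q + 1) le_rfl) hxz] at this
        linarith)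
    have hpl : p ∈ supported ℝ (I l : Set ι) :=
      supported_mono (by rintro i ⟨hi, j, hj, hij⟩; exact hl i hi j hj hij) hp
    have hpq : p ∈ supported ℝ (I (q + 1) : Set ι) := supported_mono (fun i hi => hi.1) hp
    have hsum : ∑ k ∈ Finset.range (q + 1), (f k + if k = l then p else 0) = F + p := by
      rw [Finset.sum_add_distrib, Finset.sum_ite_eq' , if_pos (by simp; omega)]
    obtain ⟨h, h₁, h₂, h₃⟩ := ih (fun k hk => hRIP k (by omega))
      (fun k => f k + if k = l then p else 0)
      (fun k hk => by
        refine add_mem (hf k (by omega)) ?_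
        split_ifs with h
        · exact h ▸ hpl
        · exact zero_mem _)
      (fun x hx => by
        classical
        rw [hsum, map_add]
        let y : ι → ℝ := fun i => if ∀ k ≤ q, i ∉ I k then 0 else x i
        have hxy : ∀ k ≤ q, ∀ i ∈ I k, x i = y i := fun k hk i hi => by
          have : ¬ ∀ k ≤ q, i ∉ I k := fun h => h k hk hi
          simp only [y, if_neg this]
        have := hpY y ⟨fun k hk => hcyl _ _ _ (hxy k hk) (hx k hk), fun i hi => if_pos hi⟩
        rw [hFcongr x y hxy, eval_congr_of_mem_supported hpl (hxy l hlq)]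
        linarith)
    refine ⟨Function.update h (q + 1) (f (q + 1) - p), fun k hk => ?_, fun k hk x hx => ?_, ?_⟩
    · rcases eq_or_ne k (q + 1) with rfl | hne
      · simpa using sub_mem (hf _ le_rfl) hpq
      · simpa [hne] using h₁ k (by omega)
    · rcases eq_or_ne k (q + 1) with rfl | hne
      · let z : ι → ℝ := fun i => if i ∈ I (q + 1) then x i else 0
        have hxz : ∀ i ∈ I (q + 1), x i = z i := fun i hi => by simp [z, hi]
        have := hpZ z ⟨hcyl _ _ _ hxz hx, fun i hi => if_neg hi⟩
        rw [Function.update_self, map_sub,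
          eval_congr_of_mem_supported (hf _ le_rfl) hxz, eval_congr_of_mem_supported hpq hxz]
        linarith
      · simpa [hne] using h₂ k (by omega) x hx
    · have hupd : ∑ k ∈ Finset.range (q + 1), Function.update h (q + 1) (f (q + 1) - p) k =
          F + p := by
        rw [← hsum, ← h₃]
        refine Finset.sum_congr rfl fun k hk => Function.update_of_ne ?_ _ _
        exact (Finset.mem_range.1 hk).ne
      rw [Finset.sum_range_succ _ (q + 1), Finset.sum_range_succ _ (q + 1),
        Function.update_self, ← hF, hupd]
      ring

lemma subalgebra_supported_eq_top {ι : Type*} {s : Set ι} (B : Subalgebra ℝ (supported ℝ s))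
    (hB : ∀ i (hi : i ∈ s), (⟨X i, X_mem_supported.2 hi⟩ : supported ℝ s) ∈ B) : B = ⊤ := by
  refine Algebra.eq_top_iff.2 fun ⟨a, ha⟩ => ?_
  have hle : supported ℝ s ≤ B.map (supported ℝ s).val := by
    refine Algebra.adjoin_le ?_
    rintro _ ⟨i, hi, rfl⟩
    exact ⟨_, hB i hi, rfl⟩
  obtain ⟨b, hb, e⟩ := hle ha
  rwa [show (⟨a, ha⟩ : supported ℝ s) = b from Subtype.ext e.symm]

lemma IsSumSq.isSOSSupported {n : ℕ} {s : Set (Fin n)} {a : supported ℝ s} (ha : IsSumSq a) :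
    IsSOSSupported s (a : MvPolynomial (Fin n) ℝ) := by
  induction ha with
  | zero => exact ⟨0, Fin.elim0, fun i => i.elim0, by simp⟩
  | sq_add b _ ih =>
    obtain ⟨t, h, hh, e⟩ := ih
    refine ⟨t + 1, Fin.cons (b : MvPolynomial (Fin n) ℝ) h, fun i => ?_, ?_⟩
    · refine Fin.cases ?_ (fun i => ?_) i
      · exact b.2
      · simpa using hh i
    · simp [Fin.sum_univ_succ, e, sq]

/-- **Putinar's Positivstellensatz** in the variables indexed by `s`, with a ball constraint. -/
theorem putinar_positivstellensatz_supported {n m : ℕ} (s : Finset (Fin n)) (J : Finset (Fin m))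
    (g : Fin m → MvPolynomial (Fin n) ℝ)
    (hg : ∀ j ∈ J, g j ∈ supported ℝ (s : Set (Fin n)))
    (hball : ∃ N : ℝ, ∃ j ∈ J, g j = C N - ∑ i ∈ s, X i ^ 2)
    {f : MvPolynomial (Fin n) ℝ} (hf : f ∈ supported ℝ (s : Set (Fin n)))
    (hpos : ∀ x, (∀ j ∈ J, 0 ≤ eval x (g j)) → 0 < eval x f) :
    ∃ (σ0 : MvPolynomial (Fin n) ℝ) (σ : Fin m → MvPolynomial (Fin n) ℝ),
      IsSOSSupported (s : Set (Fin n)) σ0 ∧ (∀ j, IsSOSSupported (s : Set (Fin n)) (σ j)) ∧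
      f = σ0 + ∑ j ∈ J, σ j * g j := by
  classical
  let A := supported ℝ (s : Set (Fin n))
  let G : Fin m → A := fun j => if h : g j ∈ A then ⟨g j, h⟩ else 0
  have hG : ∀ j ∈ J, (G j : MvPolynomial (Fin n) ℝ) = g j := fun j hj => by
    simp only [G, A, dif_pos (hg j hj)]
  let M : Set A := {a | ∃ (σ0 : A) (σ : Fin m → A), IsSumSq σ0 ∧ (∀ j, IsSumSq (σ j)) ∧
    a = σ0 + ∑ j ∈ J, σ j * G j}
  have hM : IsQuadraticModule M :=
    { one_mem := ⟨1, 0, .one, fun _ => .zero, by simp⟩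
      add_mem := by
        rintro a b ⟨σ0, σ, h0, h, rfl⟩ ⟨τ0, τ, h0', h', rfl⟩
        refine ⟨σ0 + τ0, σ + τ, h0.add h0', fun j => (h j).add (h' j), ?_⟩
        simp only [Pi.add_apply, add_mul, Finset.sum_add_distrib]
        ring
      sq_mul_mem := by
        rintro b a ⟨σ0, σ, h0, h, rfl⟩
        refine ⟨b * b * σ0, fun j => b * b * σ j, (IsSumSq.mul_self b).mul h0,
          fun j => (IsSumSq.mul_self b).mul (h j), ?_⟩
        simp only [mul_add, Finset.mul_sum, mul_assoc] }
  have hGM : ∀ j ∈ J, G j ∈ M := fun j hj => by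
    refine ⟨0, Pi.single j 1, .zero, fun i => ?_, ?_⟩
    · rcases eq_or_ne i j with rfl | hne
      · simp
      · simp [hne, IsSumSq.zero]
    · rw [zero_add, Finset.sum_eq_single j]
      · simp
      · intro i _ hne
        simp [hne]
      · exact fun h => (h hj).elim
  have hbdd : hM.boundedSubalgebra = ⊤ := by
    obtain ⟨N, j, hj, hN⟩ := hball
    refine subalgebra_supported_eq_top _ fun i hi => ?_
    refine hM.mem_boundedSubalgebra_of_sub_mul_self_mem (N := N) ?_
    let x : Fin n → A := fun i => if h : i ∈ s then ⟨X i, X_mem_supported.2 h⟩ else 0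
    convert hM.add_mem (hGM j hj) (hM.sum_mem (s := s.erase i) (a := fun k => x k * x k)
      fun k _ => hM.mul_self_mem _) using 1
    apply Subtype.ext
    have e : ∑ k ∈ s.erase i, (x k : MvPolynomial (Fin n) ℝ) * x k = ∑ k ∈ s.erase i, X k ^ 2 := by
      refine Finset.sum_congr rfl fun k hk => ?_
      simp only [x, dif_pos (Finset.mem_of_mem_erase hk), sq]
    have e' := Finset.add_sum_erase s (fun k => (X k : MvPolynomial (Fin n) ℝ) ^ 2) hi
    simp only [Subalgebra.coe_sub, Subalgebra.coe_add, Subalgebra.coe_mul,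
      AddSubmonoidClass.coe_finsetSum, hG j hj, hN, e, ← e', Subalgebra.coe_algebraMap,
      MvPolynomial.algebraMap_eq]
    ring
  have harch : IsQuadraticModule.IsArchimedean M := fun a => by
    obtain ⟨N, -, h, -⟩ : a ∈ hM.boundedSubalgebra := hbdd ▸ Algebra.mem_top
    exact ⟨N, h⟩
  obtain ⟨σ0, σ, h0, h, e⟩ := hM.mem_of_forall_algHom_pos harch (f := ⟨f, hf⟩) (by
    intro φ hφ
    let x : Fin n → ℝ := fun i => if h : i ∈ s then φ ⟨X i, X_mem_supported.2 h⟩ else 0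
    have hx : ∀ a : A, φ a = eval x (a : MvPolynomial (Fin n) ℝ) := by
      have htop := subalgebra_supported_eq_top
        (AlgHom.equalizer φ ((aeval x).comp A.val)) (fun i hi => by
          have hi' : i ∈ s := hi
          simp [AlgHom.mem_equalizer, x, hi'])
      intro a
      have ha : a ∈ AlgHom.equalizer φ ((aeval x).comp A.val) := htop ▸ Algebra.mem_top
      simpa [AlgHom.mem_equalizer, MvPolynomial.aeval_eq_eval] using ha
    rw [hx]
    refine hpos x fun j hj => ?_
    rw [← hG j hj, ← hx]
    exact hφ _ (hGM j hj))
  refine ⟨σ0, fun j => σ j, h0.isSOSSupported, fun j => (h j).isSOSSupported, ?_⟩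
  have e' := congrArg (Subtype.val) e
  simp only [Subalgebra.coe_add, AddSubmonoidClass.coe_finsetSum, Subalgebra.coe_mul] at e'
  rw [e']
  exact congrArg _ (Finset.sum_congr rfl fun j hj => by rw [hG j hj])

/-- **Sparse Putinar Positivstellensatz**: under the correlative sparsity assumptions with
running intersection property and ball constraints, every polynomial positive on `X` admits a
sparse weighted SOS representation `f = Σ_k (σ_{k,0} + Σ_{j∈J_k} σ_{k,j}·g_j)` with
`σ_{k,0}, σ_{k,j} ∈ Σ[x, I_k]`. -/
theorem sparse_putinar_positivstellensatz (n m p : ℕ)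
    (f : MvPolynomial (Fin n) ℝ) (g : Fin m → MvPolynomial (Fin n) ℝ)
    (K : Set (Fin n → ℝ)) (hK : K = {x | ∀ j, 0 ≤ eval x (g j)})
    (I : Fin p → Finset (Fin n)) (hcover : ∀ i : Fin n, ∃ k, i ∈ I k)
    (fk : Fin p → MvPolynomial (Fin n) ℝ)
    (hfsum : f = ∑ k, fk k)
    (hfksupp : ∀ k, fk k ∈ MvPolynomial.supported ℝ ((I k : Finset (Fin n)) : Set (Fin n)))
    (J : Fin p → Finset (Fin m))
    (hJdisj : ∀ k l, k ≠ l → Disjoint (J k) (J l))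
    (hJcover : ∀ j : Fin m, ∃ k, j ∈ J k)
    (hgsupp : ∀ k, ∀ j ∈ J k,
      g j ∈ MvPolynomial.supported ℝ ((I k : Finset (Fin n)) : Set (Fin n)))
    (hRIP : RIPFinset I)
    (hball : ∀ k, ∃ N : ℝ, 0 < N ∧ ∃ j ∈ J k, g j = C N - ∑ i ∈ I k, X i ^ 2)
    (hfpos : ∀ x ∈ K, 0 < eval x f) :
    ∃ (σ0 : Fin p → MvPolynomial (Fin n) ℝ)
      (σ : Fin p → Fin m → MvPolynomial (Fin n) ℝ),
      (∀ k, IsSOSSupported ((I k : Finset (Fin n)) : Set (Fin n)) (σ0 k)) ∧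
      (∀ k, ∀ j ∈ J k, IsSOSSupported ((I k : Finset (Fin n)) : Set (Fin n)) (σ k j)) ∧
      f = ∑ k, (σ0 k + ∑ j ∈ J k, σ k j * g j) := by
  subst hK
  obtain _ | q := p
  · exact absurd (hfpos 0 fun j => (hJcover j).elim fun k => k.elim0) (by simp [hfsum])
  choose N hN j hjJ hgj using hball
  have hlt : ∀ {k}, k ≤ q → k < q + 1 := Nat.lt_succ_of_le
  let I' : ℕ → Finset (Fin n) := fun k => if h : k < q + 1 then I ⟨k, h⟩ else ∅
  let f' : ℕ → MvPolynomial (Fin n) ℝ := fun k => if h : k < q + 1 then fk ⟨k, h⟩ else 0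
  let K' : ℕ → Set (Fin n → ℝ) :=
    fun k => {x | ∀ (h : k < q + 1), ∀ j ∈ J ⟨k, h⟩, 0 ≤ eval x (g j)}
  have hI' : ∀ {k} (h : k < q + 1), I' k = I ⟨k, h⟩ := fun h => dif_pos h
  have hf' : ∀ {k} (h : k < q + 1), f' k = fk ⟨k, h⟩ := fun h => dif_pos h
  have hsum' : ∑ k ∈ Finset.range (q + 1), f' k = f := by
    rw [Finset.sum_range, hfsum]
    exact Finset.sum_congr rfl fun k _ => hf' k.2
  obtain ⟨h, h₁, h₂, h₃⟩ := exists_sum_eq_of_sum_pos I' K'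
    (fun k => by
      simp only [K', Set.ofPred_forall]
      exact isClosed_iInter fun _ => isClosed_iInter fun j => isClosed_iInter fun _ =>
        isClosed_le continuous_const (continuous_eval (g j)))
    (fun k x y hxy hx hk j hj => by
      rw [← eval_congr_of_mem_supported (hgsupp _ j hj) (fun i hi => hxy i (hI' hk ▸ hi))]
      exact hx hk j hj)
    (fun k => by
      by_cases hk : k < q + 1
      · refine ⟨√(N ⟨k, hk⟩), fun x hx i hi => Real.abs_le_sqrt ?_⟩
        have h0 := hx hk _ (hjJ ⟨k, hk⟩)
        rw [hgj] at h0
        simp only [map_sub, map_sum, map_pow, eval_C, eval_X] at h0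
        have h1 := Finset.single_le_sum (f := fun i => x i ^ 2) (fun i _ => sq_nonneg _)
          (hI' hk ▸ hi)
        linarith
      · exact ⟨0, fun x _ i hi => by
          rw [show I' k = ∅ from dif_neg hk] at hi
          simp at hi⟩)
    q
    (fun k hk => by
      obtain ⟨l, hlk, hl⟩ := hRIP k (by omega)
      refine ⟨l, hlk, fun i hi j hj hij => ?_⟩
      rw [hI' l.2]
      rw [hI' (by omega)] at hi hij
      refine hl (Finset.mem_inter.2 ⟨hi, Finset.mem_biUnion.2 ⟨⟨j, by omega⟩, ?_, hij⟩⟩)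
      simpa using hj)
    f'
    (fun k hk => by
      rw [hI' (hlt hk), hf' (hlt hk)]
      exact hfksupp _)
    (fun x hx => by
      rw [hsum']
      refine hfpos x fun j => ?_
      obtain ⟨k, hk⟩ := hJcover j
      exact hx k (by omega) k.2 j hk)
  have hput := fun k : Fin (q + 1) => putinar_positivstellensatz_supported (I k) (J k) g (hgsupp k)
    ⟨N k, j k, hjJ k, hgj k⟩ (f := h k) (by simpa [hI' k.2] using h₁ k (by omega))
    (fun x hx => h₂ k (by omega) x fun _ => hx)
  choose σ0 σ hσ0 hσ e using hput
  refine ⟨σ0, σ, hσ0, fun k j _ => hσ k j, ?_⟩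
  rw [← hsum', ← h₃, Finset.sum_range]
  exact Finset.sum_congr rfl fun k _ => e k
end

section
/- Measure reformulation of fractional programming: let X ⊆ ℝⁿ be a nonempty compact set and let p₁,…,p_t, q₁,…,q_t ∈ ℝ[x₁,…,xₙ] with qᵢ(x) > 0 for all x ∈ X and all i. Then the infimum, over all tuples (μ₁,…,μ_t) of finite Borel measures on ℝⁿ vanishing outside X satisfying ∫ x^α·qᵢ(x) dμᵢ(x) = ∫ x^α·q₁(x) dμ₁(x) for all α ∈ ℕⁿ and all i ∈ {2,…,t}, and ∫ q₁(x) dμ₁(x) = 1, of Σ_{i=1}^t ∫ pᵢ(x) dμᵢ(x), equals the minimum over x ∈ X of Σ_{i=1}^t pᵢ(x)/qᵢ(x). -/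
open MeasureTheory MvPolynomial

/-- Polynomials are uniformly dense in the continuous functions on a compact subset of `ℝⁿ`. -/
theorem exists_mvPolynomial_near_of_continuousOn {n : ℕ} {K : Set (Fin n → ℝ)}
    (hK : IsCompact K) {g : (Fin n → ℝ) → ℝ} (hg : ContinuousOn g K) {ε : ℝ} (hε : 0 < ε) :
    ∃ p : MvPolynomial (Fin n) ℝ, ∀ x ∈ K, |eval x p - g x| ≤ ε := by
  have : CompactSpace K := isCompact_iff_compactSpace.mp hK
  let coord : Fin n → C(K, ℝ) := fun j =>
    ⟨fun x => x.1 j, (continuous_apply j).comp continuous_subtype_val⟩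
  have hsep : (aeval (R := ℝ) coord).range.SeparatesPoints := by
    intro x y hxy
    obtain ⟨j, hj⟩ := Function.ne_iff.mp (Subtype.coe_ne_coe.mpr hxy)
    exact ⟨coord j, ⟨coord j, ⟨X j, by simp⟩, rfl⟩, hj⟩
  obtain ⟨⟨_, p, rfl⟩, hp⟩ :=
    ContinuousMap.exists_mem_subalgebra_near_continuous_of_separatesPoints _ hsep
      (K.domRestrict g) hg.domRestrict ε hε
  refine ⟨p, fun x hx => ?_⟩
  have heval (p : MvPolynomial (Fin n) ℝ) :
      (aeval (R := ℝ) coord p : C(K, ℝ)) ⟨x, hx⟩ = eval x p := by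
    induction p using MvPolynomial.induction_on with
    | C a => simp
    | add p q hp hq => simp [hp, hq]
    | mul_X p j hp => simp [hp, coord]
  rw [← heval]
  exact (hp ⟨x, hx⟩).le

/-- A function continuous on a compact set is integrable for every finite measure vanishing
outside that set. -/
theorem integrable_of_continuousOn_of_measure_compl_eq_zero {E : Type*} [TopologicalSpace E]
    [T2Space E] [MeasurableSpace E] [BorelSpace E] {K : Set E} (hK : IsCompact K)
    {μ : Measure E} [IsFiniteMeasure μ] (hμ : μ Kᶜ = 0) {g : E → ℝ} (hg : ContinuousOn g K) :
    Integrable g μ := by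
  have h : IntegrableOn g K μ := hg.integrableOn_compact hK
  rwa [IntegrableOn, Measure.restrict_eq_self_of_ae_mem (mem_ae_iff.mpr hμ)] at h

/-- If all weighted monomial moments of two measures carried by a compact set agree, then so do
the weighted integrals of all functions continuous on that set. -/
theorem integral_mul_eq_of_moments_eq {n : ℕ} {K : Set (Fin n → ℝ)} (hK : IsCompact K)
    {μ ν : Measure (Fin n → ℝ)} [IsFiniteMeasure μ] [IsFiniteMeasure ν]
    (hμ : μ Kᶜ = 0) (hν : ν Kᶜ = 0) {q r : (Fin n → ℝ) → ℝ}
    (hq : ContinuousOn q K) (hr : ContinuousOn r K)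
    (hmom : ∀ α : Fin n → ℕ,
      ∫ x, (∏ j, x j ^ α j) * q x ∂μ = ∫ x, (∏ j, x j ^ α j) * r x ∂ν)
    {g : (Fin n → ℝ) → ℝ} (hg : ContinuousOn g K) :
    ∫ x, g x * q x ∂μ = ∫ x, g x * r x ∂ν := by
  have hcont (p : MvPolynomial (Fin n) ℝ) : ContinuousOn (fun x => eval x p) K :=
    (MvPolynomial.continuous_eval p).continuousOn
  have hpoly (p : MvPolynomial (Fin n) ℝ) :
      ∫ x, eval x p * q x ∂μ = ∫ x, eval x p * r x ∂ν := by
    have hmono (d : Fin n →₀ ℕ) : ContinuousOn (fun x : Fin n → ℝ => ∏ j, x j ^ d j) K := by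
      fun_prop
    simp only [eval_eq', Finset.sum_mul, mul_assoc]
    rw [integral_finsetSum _ fun d _ =>
        (integrable_of_continuousOn_of_measure_compl_eq_zero hK hμ
          ((hmono d).fun_mul hq)).const_mul _,
      integral_finsetSum _ fun d _ =>
        (integrable_of_continuousOn_of_measure_compl_eq_zero hK hν
          ((hmono d).fun_mul hr)).const_mul _]
    simp only [integral_const_mul, hmom]
  have happrox {ρ : Measure (Fin n → ℝ)} [IsFiniteMeasure ρ] (hρ : ρ Kᶜ = 0)
      {s : (Fin n → ℝ) → ℝ} (hs : ContinuousOn s K) {ε : ℝ}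
      {p : MvPolynomial (Fin n) ℝ} (hp : ∀ x ∈ K, |eval x p - g x| ≤ ε) :
      |∫ x, eval x p * s x ∂ρ - ∫ x, g x * s x ∂ρ| ≤ ε * ∫ x, |s x| ∂ρ := by
    have hint {f : (Fin n → ℝ) → ℝ} (hf : ContinuousOn f K) : Integrable f ρ :=
      integrable_of_continuousOn_of_measure_compl_eq_zero hK hρ hf
    rw [← integral_sub (hint ((hcont p).fun_mul hs)) (hint (hg.fun_mul hs)), ← integral_const_mul]
    refine abs_integral_le_integral_abs.trans
      (integral_mono_ae (hint (((hcont p).fun_mul hs).sub (hg.fun_mul hs))).abs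
        ((hint hs).abs.const_mul ε) ?_)
    filter_upwards [mem_ae_iff.mpr hρ] with x hx
    rw [← sub_mul, abs_mul]
    exact mul_le_mul_of_nonneg_right (hp x hx) (abs_nonneg _)
  set M := ∫ x, |q x| ∂μ + ∫ x, |r x| ∂ν
  have hM : 0 ≤ M := by positivity
  refine eq_of_abs_sub_le_all fun ε hε => ?_
  obtain ⟨p, hp⟩ := exists_mvPolynomial_near_of_continuousOn hK hg
    (show 0 < ε / (M + 1) by positivity)
  have h₁ := abs_le.mp (happrox hμ hq hp)
  have h₂ := abs_le.mp (happrox hν hr hp)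
  have h₃ : ε / (M + 1) * M ≤ ε := by
    rw [div_mul_eq_mul_div, div_le_iff₀ (by positivity)]
    nlinarith
  rw [mul_add] at h₃
  rw [hpoly p] at h₁
  exact abs_le.mpr ⟨by linarith, by linarith⟩

/-- **Measure reformulation of fractional programming**: for a nonempty compact `X ⊆ ℝⁿ` and
polynomials `pᵢ, qᵢ` with `qᵢ > 0` on `X`, the infimum of `Σᵢ ∫ pᵢ dμᵢ` over tuples of finite
Borel measures `μᵢ` vanishing outside `X` with `∫ x^α qᵢ dμᵢ = ∫ x^α q₁ dμ₁` for all `α, i` and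
`∫ q₁ dμ₁ = 1` equals the minimum of `Σᵢ pᵢ/qᵢ` over `X`. -/
theorem fractional_programming_measure_reformulation (n t : ℕ) (ht : 0 < t)
    (K : Set (Fin n → ℝ)) (hKc : IsCompact K) (hKne : K.Nonempty)
    (P Q : Fin t → MvPolynomial (Fin n) ℝ)
    (hQpos : ∀ i : Fin t, ∀ x ∈ K, 0 < eval x (Q i)) :
    sInf {v : ℝ | ∃ μ : Fin t → Measure (Fin n → ℝ),
        (∀ i, IsFiniteMeasure (μ i)) ∧
        (∀ i, μ i (Kᶜ) = 0) ∧
        (∀ (α : Fin n → ℕ) (i : Fin t),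
          ∫ x, (∏ j, x j ^ α j) * eval x (Q i) ∂(μ i) =
            ∫ x, (∏ j, x j ^ α j) * eval x (Q ⟨0, ht⟩) ∂(μ ⟨0, ht⟩)) ∧
        (∫ x, eval x (Q ⟨0, ht⟩) ∂(μ ⟨0, ht⟩)) = 1 ∧
        v = ∑ i, ∫ x, eval x (P i) ∂(μ i)} =
      sInf {v : ℝ | ∃ x ∈ K, v = ∑ i, eval x (P i) / eval x (Q i)} := by
  have hcont (p : MvPolynomial (Fin n) ℝ) : ContinuousOn (fun x => eval x p) K :=
    (MvPolynomial.continuous_eval p).continuousOn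
  have hfrac (i : Fin t) : ContinuousOn (fun x => eval x (P i) / eval x (Q i)) K :=
    (hcont _).div (hcont _) fun x hx => (hQpos i x hx).ne'
  have hsum : ContinuousOn (fun x => ∑ i, eval x (P i) / eval x (Q i)) K :=
    continuousOn_finsetSum _ fun i _ => hfrac i
  obtain ⟨x₀, hx₀, hmin⟩ := hKc.exists_isMinOn hKne hsum
  have hright : IsLeast {v : ℝ | ∃ x ∈ K, v = ∑ i, eval x (P i) / eval x (Q i)}
      (∑ i, eval x₀ (P i) / eval x₀ (Q i)) := by
    refine ⟨⟨x₀, hx₀, rfl⟩, ?_⟩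
    rintro _ ⟨x, hx, rfl⟩
    exact hmin hx
  rw [hright.csInf_eq]
  refine IsLeast.csInf_eq ⟨?_, ?_⟩
  · have hdirac (i : Fin t) (f : (Fin n → ℝ) → ℝ) :
        ∫ x, f x ∂(ENNReal.ofReal (eval x₀ (Q i))⁻¹ • Measure.dirac x₀) =
          (eval x₀ (Q i))⁻¹ * f x₀ := by
      rw [integral_smul_measure, integral_dirac,
        ENNReal.toReal_ofReal (inv_nonneg.mpr (hQpos i x₀ hx₀).le), smul_eq_mul]
    have hne (i : Fin t) : eval x₀ (Q i) ≠ 0 := (hQpos i x₀ hx₀).ne'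
    refine ⟨fun i => ENNReal.ofReal (eval x₀ (Q i))⁻¹ • Measure.dirac x₀,
      fun i => Measure.smul_finite _ ENNReal.ofReal_ne_top, fun i => ?_, fun α i => ?_, ?_, ?_⟩
    · rw [Measure.smul_apply, Measure.dirac_apply' _ hKc.measurableSet.compl]
      simp [hx₀]
    · rw [hdirac, hdirac, mul_left_comm, mul_left_comm (eval x₀ (Q ⟨0, ht⟩))⁻¹,
        inv_mul_cancel₀ (hne _), inv_mul_cancel₀ (hne _)]
    · rw [hdirac, inv_mul_cancel₀ (hne _)]
    · simp only [hdirac, div_eq_inv_mul]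
  · rintro _ ⟨μ, hfin, hμ, hmom, hone, rfl⟩
    have hint (i : Fin t) {f : (Fin n → ℝ) → ℝ} (hf : ContinuousOn f K) : Integrable f (μ i) :=
      integrable_of_continuousOn_of_measure_compl_eq_zero hKc (hμ i) hf
    have htransfer (i : Fin t) : ∫ x, eval x (P i) ∂(μ i) =
        ∫ x, eval x (P i) / eval x (Q i) * eval x (Q ⟨0, ht⟩) ∂(μ ⟨0, ht⟩) := by
      rw [← integral_mul_eq_of_moments_eq hKc (hμ i) (hμ ⟨0, ht⟩) (hcont (Q i))
        (hcont (Q ⟨0, ht⟩)) (fun α => hmom α i) (hfrac i)]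
      refine integral_congr_ae ?_
      filter_upwards [mem_ae_iff.mpr (hμ i)] with x hx
      rw [div_mul_cancel₀ _ (hQpos i x hx).ne']
    simp only [htransfer]
    rw [← integral_finsetSum _ fun i _ => hint _ ((hfrac i).fun_mul (hcont _)),
      ← mul_one (∑ i, eval x₀ (P i) / eval x₀ (Q i)), ← hone, ← integral_const_mul]
    simp only [← Finset.sum_mul]
    refine integral_mono_ae ((hint _ (hcont _)).const_mul _) (hint _ (hsum.fun_mul (hcont _))) ?_
    filter_upwards [mem_ae_iff.mpr (hμ ⟨0, ht⟩)] with x hx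
    exact mul_le_mul_of_nonneg_right (hmin hx) (hQpos _ x hx).le
end

section
/- Term-sparsity pattern for scaled diagonally dominant Gram matrices (key step of the comparison of the TSSOS bound with the SDSOS bound): let f ∈ ℝ[x₁,…,xₙ] with support A ⊆ ℕⁿ, and let B ⊆ ℕⁿ be a finite monomial basis. If f admits a scaled diagonally dominant Gram matrix indexed by B, then f admits a scaled diagonally dominant (hence positive semidefinite) Gram matrix G̃ indexed by B satisfying G̃_{βγ} = 0 whenever β ≠ γ and β + γ ∉ A ∪ 2B, where 2B = {2δ : δ ∈ B}. -/
open MvPolynomial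

/-- A real symmetric matrix is diagonally dominant if each diagonal entry dominates the sum of
the absolute values of the off-diagonal entries in its row. -/
def DiagDominant {ι : Type*} [Fintype ι] [DecidableEq ι] (M : Matrix ι ι ℝ) : Prop :=
  ∀ i, ∑ j ∈ Finset.univ.erase i, |M i j| ≤ M i i

/-- A real symmetric matrix is scaled diagonally dominant if `D M D` is diagonally dominant for
some diagonal matrix `D` with positive diagonal. -/
def ScaledDiagDominant {ι : Type*} [Fintype ι] [DecidableEq ι] (M : Matrix ι ι ℝ) : Prop :=
  ∃ D : ι → ℝ, (∀ i, 0 < D i) ∧ DiagDominant (Matrix.of fun i j => D i * M i j * D j)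

/-- The quadratic form of a symmetric diagonally dominant matrix is nonnegative. -/
theorem DiagDominant.sum_mul_nonneg {ι : Type*} [Fintype ι] [DecidableEq ι] {M : Matrix ι ι ℝ}
    (hM : DiagDominant M) (hsym : M.IsSymm) (y : ι → ℝ) :
    0 ≤ ∑ i, ∑ j, M i j * (y i * y j) := by
  set N : ι → ι → ℝ := fun i j => if i = j then M i i else -|M i j| with hN
  have hNsym (i j : ι) : N i j = N j i := by
    by_cases h : i = j
    · rw [h]
    · simp [hN, h, Ne.symm h, hsym.apply i j]
  have hrow (i : ι) : 0 ≤ ∑ j, N i j := by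
    rw [← Finset.add_sum_erase _ _ (Finset.mem_univ i)]
    have : ∑ j ∈ Finset.univ.erase i, N i j = -∑ j ∈ Finset.univ.erase i, |M i j| := by
      rw [← Finset.sum_neg_distrib]
      refine Finset.sum_congr rfl fun j hj => ?_
      simp [hN, (Finset.ne_of_mem_erase hj).symm]
    have hii : N i i = M i i := by simp [hN]
    rw [this, hii]
    linarith [hM i]
  have hterm (i j : ι) : N i j * (y i ^ 2 + y j ^ 2) / 2 ≤ M i j * (y i * y j) := by
    by_cases h : i = j
    · subst h
      simp only [hN, if_true]
      exact le_of_eq (by ring)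
    · simp only [hN, if_neg h]
      rcases abs_cases (M i j) with ⟨h1, h2⟩ | ⟨h1, h2⟩ <;> rw [h1]
      · nlinarith [mul_nonneg h2 (sq_nonneg (y i + y j))]
      · nlinarith [mul_nonneg (neg_nonneg.mpr h2.le) (sq_nonneg (y i - y j))]
  have hswap : ∑ i, ∑ j, N i j * y j ^ 2 = ∑ i, ∑ j, N i j * y i ^ 2 := by
    rw [Finset.sum_comm]
    exact Finset.sum_congr rfl fun i _ => Finset.sum_congr rfl fun j _ => by rw [hNsym]
  calc 0 ≤ ∑ i, (∑ j, N i j) * y i ^ 2 :=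
        Finset.sum_nonneg fun i _ => mul_nonneg (hrow i) (sq_nonneg _)
    _ = ∑ i, ∑ j, N i j * (y i ^ 2 + y j ^ 2) / 2 := by
        simp only [mul_add, add_div, Finset.sum_add_distrib, ← Finset.sum_div, hswap,
          Finset.sum_mul]
        ring
    _ ≤ _ := Finset.sum_le_sum fun i _ => Finset.sum_le_sum fun j _ => hterm i j

/-- A symmetric scaled diagonally dominant matrix is positive semidefinite. -/
theorem ScaledDiagDominant.posSemidef {ι : Type*} [Fintype ι] [DecidableEq ι] {M : Matrix ι ι ℝ}
    (hM : ScaledDiagDominant M) (hsym : M.IsSymm) : M.PosSemidef := by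
  obtain ⟨D, hD, hdom⟩ := hM
  refine Matrix.PosSemidef.of_dotProduct_mulVec_nonneg ?_ fun x => ?_
  · rw [Matrix.IsHermitian, Matrix.conjTranspose_eq_transpose_of_trivial]
    exact hsym
  · have h := hdom.sum_mul_nonneg
      (Matrix.IsSymm.ext fun i j => by simp only [Matrix.of_apply, hsym.apply i j]; ring)
      fun i => x i / D i
    refine h.trans_eq ?_
    simp only [dotProduct, Matrix.mulVec, star_trivial, Finset.mul_sum, Matrix.of_apply]
    refine Finset.sum_congr rfl fun i _ => Finset.sum_congr rfl fun j _ => ?_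
    have := (hD i).ne'
    have := (hD j).ne'
    field_simp

/-- Replacing off-diagonal entries by zero preserves scaled diagonal dominance. -/
theorem ScaledDiagDominant.of_zero_offDiag {ι : Type*} [Fintype ι] [DecidableEq ι]
    {M M' : Matrix ι ι ℝ} (hM : ScaledDiagDominant M) (hdiag : ∀ i, M' i i = M i i)
    (hoff : ∀ i j, M' i j = M i j ∨ M' i j = 0) : ScaledDiagDominant M' := by
  obtain ⟨D, hD, hdom⟩ := hM
  refine ⟨D, hD, fun i => ?_⟩
  have h := hdom i
  simp only [Matrix.of_apply] at h ⊢
  rw [hdiag i]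
  refine le_trans (Finset.sum_le_sum fun j _ => ?_) h
  rcases hoff i j with h' | h'
  · rw [h']
  · rw [h', mul_zero, zero_mul, abs_zero]
    exact abs_nonneg _

/-- **Term-sparsity pattern for scaled diagonally dominant Gram matrices**: if `f` admits a
scaled diagonally dominant Gram matrix indexed by the monomial basis `B`, then it admits a
scaled diagonally dominant (hence PSD) Gram matrix vanishing at off-diagonal positions `(β,γ)`
with `β + γ ∉ supp f ∪ 2B`. -/
theorem sdd_gram_term_sparsity (n : ℕ) (f : MvPolynomial (Fin n) ℝ)
    (B : Finset (Fin n →₀ ℕ))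
    (G : Matrix {β // β ∈ B} {β // β ∈ B} ℝ) (hGsym : G.IsSymm)
    (hGram : f = ∑ β : {β // β ∈ B}, ∑ γ : {β // β ∈ B}, monomial (↑β + ↑γ) (G β γ))
    (hSDD : ScaledDiagDominant G) :
    ∃ G' : Matrix {β // β ∈ B} {β // β ∈ B} ℝ,
      G'.IsSymm ∧ ScaledDiagDominant G' ∧ G'.PosSemidef ∧
      f = ∑ β : {β // β ∈ B}, ∑ γ : {β // β ∈ B}, monomial (↑β + ↑γ) (G' β γ) ∧
      ∀ β γ : {β // β ∈ B}, β ≠ γ →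
        ¬((↑β + ↑γ : Fin n →₀ ℕ) ∈ f.support ∨
          ∃ δ ∈ B, (↑β + ↑γ : Fin n →₀ ℕ) = δ + δ) →
        G' β γ = 0 := by
  classical
  let P : (Fin n →₀ ℕ) → Prop := fun α => α ∈ f.support ∨ ∃ δ ∈ B, α = δ + δ
  let G' : Matrix {β // β ∈ B} {β // β ∈ B} ℝ :=
    Matrix.of fun β γ => if P (↑β + ↑γ) then G β γ else 0
  have hG' (β γ : {β // β ∈ B}) : G' β γ = if P (↑β + ↑γ) then G β γ else 0 := rfl
  have hsym : G'.IsSymm := Matrix.IsSymm.ext fun β γ => by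
    rw [hG', hG', hGsym.apply, add_comm (γ : Fin n →₀ ℕ)]
  have hsdd : ScaledDiagDominant G' := by
    refine hSDD.of_zero_offDiag (fun β => ?_) fun β γ => ?_
    · rw [hG', if_pos (Or.inr ⟨β, β.2, rfl⟩)]
    · rw [hG']
      split_ifs <;> simp
  refine ⟨G', hsym, hsdd, hsdd.posSemidef hsym, ?_, fun β γ _ h => by rw [hG', if_neg h]⟩
  ext α
  by_cases hα : P α
  · conv_lhs => rw [hGram]
    simp only [coeff_sum, coeff_monomial]
    refine Finset.sum_congr rfl fun β _ => Finset.sum_congr rfl fun γ _ => ?_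
    split_ifs with h
    · rw [hG', if_pos (h ▸ hα)]
    · rfl
  · rw [notMem_support_iff.mp fun h => hα (Or.inl h)]
    simp only [coeff_sum, coeff_monomial]
    refine (Finset.sum_eq_zero fun β _ => Finset.sum_eq_zero fun γ _ => ?_).symm
    split_ifs with h
    · rw [hG', if_neg (h ▸ hα)]
    · rfl
end
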